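/- arXiv:2102.03473 — 8 statements merged into one kernel-verified Lean document; each statement's English description precedes it below -/
import Mathlib

section
/- Let X, Y be real normed spaces, B ⊆ X a set containing 0, n ∈ ℕ, α ≥ 0 and C > 0. Suppose P(·,δ) ∈ 𝒫^n(X,Y), with homogeneous components P_k(·,δ) ∈ 𝒫_k(X,Y), is a family of polynomials indexed by δ ∈ B such that ‖P(ξ,δ)‖ ≤ C(‖ξ‖ + ‖δ‖)^{n+α} for all ξ ∈ X and δ ∈ B. Then for every k ∈ {0,…,n} there is a constant C_k, depending only on C, n, k and α, such that ‖P_k(·,δ)‖_{𝒫_k(X,Y)} ≤ C_k ‖δ‖^{n−k+α} for all δ ∈ B. -/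
open scoped BigOperators

/-- The coefficients of a polynomial of degree at most `n` are fixed linear combinations of its
values at `0, …, n`. -/
theorem exists_weights_coeff_extraction (n k : ℕ) (hk : k ≤ n) :
    ∃ c : Fin (n + 1) → ℝ, ∀ {Y : Type} [AddCommGroup Y] [Module ℝ Y] (a : ℕ → Y),
      ∑ j, c j • ∑ m ∈ Finset.range (n + 1), ((j : ℕ) : ℝ) ^ m • a m = a k := by
  let V : Matrix (Fin (n + 1)) (Fin (n + 1)) ℝ :=
    Matrix.vandermonde fun j : Fin (n + 1) => ((j : ℕ) : ℝ)
  have hV : IsUnit V.det := by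
    rw [isUnit_iff_ne_zero, Matrix.det_vandermonde_ne_zero_iff]
    intro i j hij
    exact Fin.ext (Nat.cast_injective (R := ℝ) hij)
  let k' : Fin (n + 1) := ⟨k, Nat.lt_succ_of_le hk⟩
  refine ⟨Matrix.vecMul (Pi.single k' 1) V⁻¹, ?_⟩
  intro Y _ _ a
  have hc : Matrix.vecMul (Matrix.vecMul (Pi.single k' 1) V⁻¹) V = Pi.single k' 1 := by
    rw [Matrix.vecMul_vecMul, Matrix.nonsing_inv_mul _ hV, Matrix.vecMul_one]
  generalize Matrix.vecMul (Pi.single k' 1) V⁻¹ = c at hc ⊢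
  simp_rw [Finset.sum_range, Finset.smul_sum, smul_smul]
  rw [Finset.sum_comm]
  simp_rw [← Finset.sum_smul]
  have h (m : Fin (n + 1)) :
      ∑ j, c j * ((j : ℕ) : ℝ) ^ (m : ℕ) = (Pi.single k' 1 : Fin (n + 1) → ℝ) m := by
    rw [← hc]
    rfl
  simp_rw [h]
  rw [Finset.sum_eq_single k' (fun m _ hm => by simp [Pi.single_eq_of_ne hm]) (by simp)]
  simp [k']

/-- **Corollary 2.2.** If a family of polynomials `P(·,δ) ∈ 𝒫ⁿ(X,Y)` indexed by `δ ∈ B`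
(`0 ∈ B`) satisfies `‖P(ξ,δ)‖ ≤ C(‖ξ‖+‖δ‖)^{n+α}`, then the homogeneous components
satisfy `‖P_k(·,δ)‖ ≤ C_k ‖δ‖^{n-k+α}`, with `C_k` depending only on `C`, `n`, `k` (and `α`). -/
theorem stmt_1 (n : ℕ) (α C : ℝ) (hα : 0 ≤ α) (hC : 0 < C) (k : ℕ) (hk : k ≤ n) :
    ∃ Ck : ℝ,
      ∀ (X Y : Type) [NormedAddCommGroup X] [NormedSpace ℝ X]
        [NormedAddCommGroup Y] [NormedSpace ℝ Y]
        (B : Set X), (0 : X) ∈ B →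
        ∀ (P : X → X → Y)
          (Pk : (m : ℕ) → X → ContinuousMultilinearMap ℝ (fun _ : Fin m => X) Y),
          (∀ (m : ℕ) (δ : X) (v : Fin m → X) (σ : Equiv.Perm (Fin m)),
              Pk m δ (v ∘ σ) = Pk m δ v) →
          (∀ ξ δ : X,
              P ξ δ = ∑ m ∈ Finset.range (n + 1), (m.factorial : ℝ)⁻¹ • Pk m δ (fun _ => ξ)) →
          (∀ ξ : X, ∀ δ ∈ B, ‖P ξ δ‖ ≤ C * (‖ξ‖ + ‖δ‖) ^ ((n : ℝ) + α)) →
          ∀ δ ∈ B, ∀ ξ : X,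
            ‖Pk k δ (fun _ => ξ)‖ ≤ Ck * ‖δ‖ ^ ((n : ℝ) - (k : ℝ) + α) * ‖ξ‖ ^ k := by
  obtain ⟨c, hc⟩ := exists_weights_coeff_extraction n k hk
  refine ⟨k.factorial * ((∑ j, |c j|) * (C * ((n : ℝ) + 1) ^ ((n : ℝ) + α))), ?_⟩
  intro X Y _ _ _ _ B _ P Pk _ hP hbound δ hδ ξ
  have hkn : (k : ℝ) ≤ n := by exact_mod_cast hk
  have hexp : 0 ≤ (n : ℝ) - k + α := by linarith
  set A : ℝ := (∑ j, |c j|) * (C * ((n : ℝ) + 1) ^ ((n : ℝ) + α)) with hA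
  have key (ε : ℝ) (hε : 0 < ε) : ‖Pk k δ (fun _ => ξ)‖ ≤
      k.factorial * A * (‖δ‖ + ε) ^ ((n : ℝ) - k + α) * (‖ξ‖ + ε) ^ k := by
    set r := ‖δ‖ + ε with hr_def
    set ρ := ‖ξ‖ + ε with hρ_def
    have hr : 0 < r := by positivity
    have hρ : 0 < ρ := by positivity
    have hval (t : ℝ) : P (t • ξ) δ = ∑ m ∈ Finset.range (n + 1),
        t ^ m • ((m.factorial : ℝ)⁻¹ • Pk m δ (fun _ => ξ)) := by
      rw [hP]
      refine Finset.sum_congr rfl fun m _ => ?_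
      have := (Pk m δ).map_smul_univ (fun _ => t) (fun _ => ξ)
      simp only [Finset.prod_const, Finset.card_univ, Fintype.card_fin] at this
      rw [this, smul_comm]
    have hcoeff : ∑ j : Fin (n + 1), c j • P ((((j : ℕ) : ℝ) * (r / ρ)) • ξ) δ =
        (r / ρ) ^ k • ((k.factorial : ℝ)⁻¹ • Pk k δ (fun _ => ξ)) := by
      rw [← hc fun m => (r / ρ) ^ m • ((m.factorial : ℝ)⁻¹ • Pk m δ (fun _ => ξ))]
      simp_rw [hval, mul_pow, mul_smul]
    have hterm (j : Fin (n + 1)) : ‖P ((((j : ℕ) : ℝ) * (r / ρ)) • ξ) δ‖ ≤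
        C * ((n : ℝ) + 1) ^ ((n : ℝ) + α) * r ^ ((n : ℝ) + α) := by
      refine (hbound _ δ hδ).trans ?_
      rw [mul_assoc, ← Real.mul_rpow (by positivity) hr.le]
      have hj : ((j : ℕ) : ℝ) ≤ n := by exact_mod_cast Nat.lt_succ_iff.mp j.2
      have hξ : r / ρ * ‖ξ‖ ≤ r := by
        rw [div_mul_eq_mul_div, div_le_iff₀ hρ]
        exact mul_le_mul_of_nonneg_left (by linarith) hr.le
      gcongr
      rw [norm_smul, Real.norm_of_nonneg (by positivity), mul_assoc, add_mul, one_mul]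
      have : ‖δ‖ ≤ r := by linarith
      gcongr
    have hmain : (r / ρ) ^ k * ((k.factorial : ℝ)⁻¹ * ‖Pk k δ (fun _ => ξ)‖) ≤
        A * r ^ ((n : ℝ) + α) := by
      have hnorm := congrArg norm hcoeff
      rw [norm_smul, norm_smul, Real.norm_of_nonneg (by positivity),
        Real.norm_of_nonneg (by positivity)] at hnorm
      rw [← hnorm, hA, mul_assoc, Finset.sum_mul]
      refine norm_sum_le_of_le _ fun j _ => ?_
      rw [norm_smul, Real.norm_eq_abs]
      exact mul_le_mul_of_nonneg_left (hterm j) (abs_nonneg _)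
    have hsplit : r ^ ((n : ℝ) + α) = r ^ ((n : ℝ) - k + α) * r ^ k := by
      rw [← Real.rpow_natCast r k, ← Real.rpow_add hr]
      congr 1
      ring
    rw [hsplit, div_pow] at hmain
    have hfac : (0 : ℝ) < k.factorial := by positivity
    refine le_of_mul_le_mul_left (hmain.trans_eq' ?_ |>.trans_eq ?_)
      (show 0 < r ^ k / ρ ^ k * (k.factorial : ℝ)⁻¹ by positivity)
    · ring
    · field_simp
  have hcont : Continuous fun ε : ℝ =>
      k.factorial * A * (‖δ‖ + ε) ^ ((n : ℝ) - k + α) * (‖ξ‖ + ε) ^ k :=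
    (continuous_const.mul ((Real.continuous_rpow_const hexp).comp
      (continuous_const.add continuous_id))).mul ((continuous_const.add continuous_id).pow k)
  have hlim := (hcont.tendsto 0).mono_left (nhdsWithin_le_nhds (s := Set.Ioi 0))
  simp only [add_zero] at hlim
  exact ge_of_tendsto hlim (Filter.eventually_of_mem self_mem_nhdsWithin key)
end

section
/- Componentwise form of the compatibility conditions: let X, Y be real normed spaces, V ⊆ X, n ∈ ℕ, α ∈ (0,1], C > 0, and for each u ∈ V let P(·,u) = Σ_{l=0}^n (1/l!) P_l([{ξ}^l],u) ∈ 𝒫^n(X,Y), where P_l(·,u) is the symmetric l-linear map generating the l-th homogeneous component. If ‖P(ξ+δ, u) − P(ξ, u+δ)‖ ≤ C (‖ξ‖ + ‖δ‖)^{n+α} for all u, u+δ ∈ V and ξ ∈ X, then for every l ∈ {0,…,n} there is a constant C', depending only on C, n, l and α, such that ‖P_l({ξ}^l, u+δ) − Σ_{k=0}^{n−l} (1/k!) P_{l+k}([{ξ}^l, {δ}^k], u)‖ ≤ C' ‖ξ‖^l ‖δ‖^{n−l+α} for all u, u+δ ∈ V and ξ ∈ X, where {ξ}^l denotes ξ repeated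 l times. -/
/-- A symmetric function of `m` variables takes the same value on every arrangement of
`s.card` copies of `x` and `m - s.card` copies of `y`. -/
theorem apply_piecewise_eq_of_symmetric {X Y : Type*} {m : ℕ} (f : (Fin m → X) → Y)
    (hf : ∀ (v : Fin m → X) (σ : Equiv.Perm (Fin m)), f (v ∘ σ) = f v)
    (s : Finset (Fin m)) (x y : X) :
    f (s.piecewise (fun _ => x) (fun _ => y)) =
      f (fun i : Fin m => if (i : ℕ) < s.card then x else y) := by
  classical
  have hcard : Fintype.card {i : Fin m // (i : ℕ) < s.card} = Fintype.card {i // i ∈ s} := by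
    have h : s.card ≤ m := by simpa using s.card_le_univ
    rw [Fintype.card_subtype, Fintype.card_coe, Fin.card_filter_val_lt, min_eq_right h]
  let e := Fintype.equivOfCardEq hcard
  rw [← hf _ e.extendSubtype]
  congr 1
  funext i
  by_cases hi : (i : ℕ) < s.card
  · simp [hi, Finset.piecewise_eq_of_mem _ _ _ (e.extendSubtype_mem i hi)]
  · simp [hi, Finset.piecewise_eq_of_notMem _ _ _ (e.extendSubtype_not_mem i hi)]

/-- The binomial formula for a symmetric multilinear map on the diagonal. -/
theorem MultilinearMap.map_add_diag_of_symmetric {X Y : Type*} [AddCommGroup X] [Module ℝ X]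
    [AddCommGroup Y] [Module ℝ Y] {m : ℕ} (f : MultilinearMap ℝ (fun _ : Fin m => X) Y)
    (hf : ∀ (v : Fin m → X) (σ : Equiv.Perm (Fin m)), f (v ∘ σ) = f v) (x y : X) :
    f (fun _ => x + y) = ∑ c ∈ Finset.range (m + 1),
      (m.choose c : ℝ) • f (fun i : Fin m => if (i : ℕ) < c then x else y) := by
  classical
  have h := f.map_add_univ (fun _ => x) (fun _ => y)
  simp_rw [apply_piecewise_eq_of_symmetric f hf] at h
  rw [← Finset.powerset_univ, Finset.sum_powerset_apply_card
    (fun c => f (fun i : Fin m => if (i : ℕ) < c then x else y))] at h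
  simpa [Pi.add_def, ← Nat.cast_smul_eq_nsmul ℝ] using h

/-- Regrouping a truncated exponential double sum by the number of copies of the first variable. -/
theorem sum_inv_factorial_smul_sum_choose {Y : Type*} [AddCommGroup Y] [Module ℝ Y]
    (n : ℕ) (F : ℕ → ℕ → Y) :
    ∑ m ∈ Finset.range (n + 1), (m.factorial : ℝ)⁻¹ •
        ∑ c ∈ Finset.range (m + 1), (m.choose c : ℝ) • F m c =
      ∑ l ∈ Finset.range (n + 1), (l.factorial : ℝ)⁻¹ •
        ∑ k ∈ Finset.range (n - l + 1), (k.factorial : ℝ)⁻¹ • F (l + k) l := by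
  simp_rw [Finset.smul_sum, smul_smul, Finset.sum_sigma']
  refine Finset.sum_nbij' (fun p => ⟨p.2, p.1 - p.2⟩) (fun p => ⟨p.1 + p.2, p.1⟩) ?_ ?_ ?_ ?_ ?_
  · rintro ⟨m, c⟩ h
    simp only [Finset.mem_sigma, Finset.mem_range] at h ⊢
    omega
  · rintro ⟨m, c⟩ h
    simp only [Finset.mem_sigma, Finset.mem_range] at h ⊢
    omega
  · rintro ⟨m, c⟩ h
    simp only [Finset.mem_sigma, Finset.mem_range] at h
    simp [Nat.add_sub_cancel' (show c ≤ m by omega)]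
  · rintro ⟨m, c⟩ h
    simp
  · rintro ⟨m, c⟩ h
    simp only [Finset.mem_sigma, Finset.mem_range] at h
    have hc : c ≤ m := by omega
    simp only [Nat.add_sub_cancel' hc]
    congr 1
    rw [Nat.cast_choose ℝ hc]
    have := Nat.cast_ne_zero (R := ℝ).2 m.factorial_ne_zero
    field_simp

/-- A coefficient of a vector-valued polynomial of degree at most `n` is a fixed linear
combination of its values at `0, …, n`. -/
theorem exists_coeff_eq_sum_eval (n l : ℕ) (hl : l ≤ n) :
    ∃ c : Fin (n + 1) → ℝ, ∀ {Y : Type} [AddCommGroup Y] [Module ℝ Y] (a : ℕ → Y),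
      a l = ∑ j, c j • ∑ m ∈ Finset.range (n + 1), ((j : ℕ) : ℝ) ^ m • a m := by
  let A : Matrix (Fin (n + 1)) (Fin (n + 1)) ℝ := Matrix.vandermonde fun j => ((j : ℕ) : ℝ)
  have hA : IsUnit A.det := by
    refine isUnit_iff_ne_zero.2 (Matrix.det_vandermonde_ne_zero_iff.2 ?_)
    exact Nat.cast_injective.comp Fin.val_injective
  let l' : Fin (n + 1) := ⟨l, by omega⟩
  refine ⟨fun j => A⁻¹ l' j, fun {Y} _ _ a => ?_⟩
  have key : ∀ m : Fin (n + 1), ∑ j, A⁻¹ l' j * ((j : ℕ) : ℝ) ^ (m : ℕ) =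
      if l' = m then 1 else 0 := fun m => by
    simpa [Matrix.mul_apply, Matrix.one_apply, A, Matrix.vandermonde_apply] using
      congrFun (congrFun (Matrix.nonsing_inv_mul A hA) l') m
  simp_rw [Finset.sum_range, Finset.smul_sum, smul_smul]
  rw [Finset.sum_comm]
  simp_rw [← Finset.sum_smul, key]
  simp [l']

/-- The defect of the Taylor expansion of the `l`-th component is homogeneous of degree `l`. -/
theorem map_smul_sub_sum_mixed {X Y : Type*} [AddCommGroup X] [Module ℝ X]
    [AddCommGroup Y] [Module ℝ Y] (l N : ℕ) (g : MultilinearMap ℝ (fun _ : Fin l => X) Y)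
    (f : (k : ℕ) → MultilinearMap ℝ (fun _ : Fin (l + k) => X) Y) (b : ℕ → ℝ) (t : ℝ) (x y : X) :
    g (fun _ => t • x) - ∑ k ∈ Finset.range N, b k •
        f k (fun i => if (i : ℕ) < l then t • x else y) =
      t ^ l • (g (fun _ => x) - ∑ k ∈ Finset.range N, b k •
        f k (fun i => if (i : ℕ) < l then x else y)) := by
  have h1 : g (fun _ => t • x) = t ^ l • g (fun _ => x) := by
    simpa using g.map_smul_univ (fun _ => t) (fun _ => x)
  have h2 : ∀ k, f k (fun i => if (i : ℕ) < l then t • x else y) =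
      t ^ l • f k (fun i => if (i : ℕ) < l then x else y) := fun k => by
    have h := (f k).map_smul_univ (fun i => if (i : ℕ) < l then t else 1)
      (fun i => if (i : ℕ) < l then x else y)
    have hp : ∏ i : Fin (l + k), (if (i : ℕ) < l then t else 1) = t ^ l := by
      simp [Finset.prod_ite, Fin.card_filter_val_lt]
    rw [hp] at h
    rw [← h]
    congr 1
    funext i
    split_ifs <;> simp
  simp_rw [h1, h2, smul_sub, Finset.smul_sum, smul_comm (t ^ l)]

/-- **Componentwise form (2.13) of the compatibility conditions.** If the polynomials
`P(·,u) = ∑_{l=0}^n (1/l!) Pk l u [{ξ}^l]`, `u ∈ V`, satisfy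
`‖P(ξ+δ,u) − P(ξ,u+δ)‖ ≤ C(‖ξ‖+‖δ‖)^{n+α}` for `u, u+δ ∈ V`, then for every `l ≤ n`
there is `C'` (depending only on `C`, `n`, `l`, `α`) with
`‖Pl({ξ}^l, u+δ) − ∑_{k=0}^{n−l} (1/k!) P_{l+k}([{ξ}^l,{δ}^k], u)‖ ≤ C'‖ξ‖^l ‖δ‖^{n−l+α}`. -/
theorem stmt_5 (n : ℕ) (α C : ℝ) (hα : α ∈ Set.Ioc (0 : ℝ) 1) (hC : 0 < C)
    (l : ℕ) (hl : l ≤ n) :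
    ∃ C' : ℝ,
      ∀ (X Y : Type) [NormedAddCommGroup X] [NormedSpace ℝ X]
        [NormedAddCommGroup Y] [NormedSpace ℝ Y]
        (V : Set X)
        (Pk : (m : ℕ) → X → ContinuousMultilinearMap ℝ (fun _ : Fin m => X) Y),
        (∀ (m : ℕ) (u : X) (v : Fin m → X) (σ : Equiv.Perm (Fin m)),
            Pk m u (v ∘ σ) = Pk m u v) →
        (∀ u ∈ V, ∀ δ : X, u + δ ∈ V → ∀ ξ : X,
            ‖(∑ m ∈ Finset.range (n + 1), (m.factorial : ℝ)⁻¹ • Pk m u (fun _ => ξ + δ)) -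
                ∑ m ∈ Finset.range (n + 1), (m.factorial : ℝ)⁻¹ • Pk m (u + δ) (fun _ => ξ)‖ ≤
              C * (‖ξ‖ + ‖δ‖) ^ ((n : ℝ) + α)) →
        ∀ u ∈ V, ∀ δ : X, u + δ ∈ V → ∀ ξ : X,
          ‖Pk l (u + δ) (fun _ => ξ) -
              ∑ k ∈ Finset.range (n - l + 1), (k.factorial : ℝ)⁻¹ •
                Pk (l + k) u (fun i : Fin (l + k) => if (i : ℕ) < l then ξ else δ)‖ ≤
            C' * ‖ξ‖ ^ l * ‖δ‖ ^ ((n : ℝ) - (l : ℝ) + α) := by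
  obtain ⟨c, hc⟩ := exists_coeff_eq_sum_eval n l hl
  have hα0 : 0 < α := hα.1
  have hnα : 0 ≤ (n : ℝ) + α := by positivity
  refine ⟨l.factorial * ((∑ j, |c j|) * (C * ((n : ℝ) + 1) ^ ((n : ℝ) + α))), ?_⟩
  intro X Y _ _ _ _ V Pk hsymm hP u hu δ hδ ξ
  let Q : ℕ → X → Y := fun m ξ => Pk m (u + δ) (fun _ => ξ) -
    ∑ k ∈ Finset.range (n - m + 1), (k.factorial : ℝ)⁻¹ •
      Pk (m + k) u (fun i : Fin (m + k) => if (i : ℕ) < m then ξ else δ)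
  have hQ : ∀ m (t : ℝ) ξ, Q m (t • ξ) = t ^ m • Q m ξ := fun m t ξ =>
    map_smul_sub_sum_mixed m (n - m + 1) (Pk m (u + δ)).toMultilinearMap
      (fun k => (Pk (m + k) u).toMultilinearMap) (fun k => (k.factorial : ℝ)⁻¹) t ξ δ
  have hsum : ∀ ξ, ‖∑ m ∈ Finset.range (n + 1), (m.factorial : ℝ)⁻¹ • Q m ξ‖ ≤
      C * (‖ξ‖ + ‖δ‖) ^ ((n : ℝ) + α) := fun ξ => by
    have h : ∀ m, Pk m u (fun _ => ξ + δ) = ∑ c ∈ Finset.range (m + 1),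
        (m.choose c : ℝ) • Pk m u (fun i : Fin m => if (i : ℕ) < c then ξ else δ) := fun m =>
      (Pk m u).toMultilinearMap.map_add_diag_of_symmetric (hsymm m u) ξ δ
    have h' := hP u hu δ hδ ξ
    simp_rw [h] at h'
    rw [sum_inv_factorial_smul_sum_choose n
      (fun m c => Pk m u (fun i : Fin m => if (i : ℕ) < c then ξ else δ)), norm_sub_rev,
      ← Finset.sum_sub_distrib] at h'
    simpa only [Q, smul_sub] using h'
  change ‖Q l ξ‖ ≤ _
  rcases eq_or_ne δ 0 with rfl | hδ0
  · have hz : Q l ξ = 0 := by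
      simp only [Q]
      rw [Finset.sum_range_succ', Finset.sum_eq_zero]
      · simp
      · intro k _
        rw [(Pk (l + (k + 1)) u).map_coord_zero ⟨l, by omega⟩ (by simp), smul_zero]
    rw [hz, norm_zero]
    positivity
  have hδp : 0 < ‖δ‖ := norm_pos_iff.2 hδ0
  -- Rescaling `ξ` to length `‖δ‖` (or `0`).
  let r : ℝ := ‖δ‖ / ‖ξ‖
  have hr0 : 0 ≤ r := by positivity
  have hr : r * ‖ξ‖ ≤ ‖δ‖ := by
    rcases eq_or_ne ξ 0 with rfl | hξ0
    · simp
    · exact (div_mul_cancel₀ _ (norm_ne_zero_iff.2 hξ0)).le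
  have hvals : ∀ j : Fin (n + 1), ‖∑ m ∈ Finset.range (n + 1), ((j : ℕ) : ℝ) ^ m •
      ((m.factorial : ℝ)⁻¹ • Q m (r • ξ))‖ ≤
      C * ((n : ℝ) + 1) ^ ((n : ℝ) + α) * ‖δ‖ ^ ((n : ℝ) + α) := fun j => by
    have h := hsum (((j : ℕ) : ℝ) • r • ξ)
    simp_rw [hQ _ ((j : ℕ) : ℝ), smul_comm _ (((j : ℕ) : ℝ) ^ _)] at h
    refine h.trans ?_
    rw [mul_assoc, ← Real.mul_rpow (by positivity) (norm_nonneg _)]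
    gcongr
    rw [norm_smul, norm_smul, Real.norm_of_nonneg hr0, Real.norm_natCast, add_mul, one_mul]
    gcongr
    exact_mod_cast Nat.lt_succ_iff.1 j.2
  have hmain : ‖(l.factorial : ℝ)⁻¹ • Q l (r • ξ)‖ ≤
      (∑ j, |c j|) * (C * ((n : ℝ) + 1) ^ ((n : ℝ) + α) * ‖δ‖ ^ ((n : ℝ) + α)) := by
    rw [hc (fun m => (m.factorial : ℝ)⁻¹ • Q m (r • ξ)), Finset.sum_mul]
    refine norm_sum_le_of_le _ fun j _ => ?_
    rw [norm_smul, Real.norm_eq_abs]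
    exact mul_le_mul_of_nonneg_left (hvals j) (abs_nonneg _)
  have hscale : ‖δ‖ ^ l * ‖Q l ξ‖ = ‖ξ‖ ^ l * ‖Q l (r • ξ)‖ := by
    rw [hQ, norm_smul, norm_pow, Real.norm_of_nonneg hr0, ← mul_assoc, ← mul_pow]
    rcases eq_or_ne ξ 0 with rfl | hξ0
    · rcases Nat.eq_zero_or_pos l with rfl | hlp
      · simp
      · have h := hQ l 0 0
        rw [zero_smul, zero_pow hlp.ne', zero_smul] at h
        simp [h]
    · rw [mul_div_cancel₀ _ (norm_ne_zero_iff.2 hξ0)]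
  rw [norm_smul, norm_inv, Real.norm_natCast, inv_mul_le_iff₀ (by positivity)] at hmain
  have hpow : ‖δ‖ ^ ((n : ℝ) + α) = ‖δ‖ ^ l * ‖δ‖ ^ ((n : ℝ) - l + α) := by
    rw [← Real.rpow_natCast, ← Real.rpow_add hδp]
    ring_nf
  refine le_of_mul_le_mul_left ?_ (pow_pos hδp l)
  rw [hscale]
  refine (mul_le_mul_of_nonneg_left hmain (by positivity)).trans_eq ?_
  rw [hpow]
  ring
end

section
/- Whitney extension theorem: let X be a finite-dimensional real normed space, Y a real Banach space, V ⊆ X an arbitrary set, n ∈ ℕ, α ∈ (0,1] and C > 0. Suppose that for each u ∈ V a polynomial P(·,u) ∈ 𝒫^n(X,Y) is given such that ‖P(ξ+δ, u) − P(ξ, u+δ)‖ ≤ C (‖ξ‖ + ‖δ‖)^{n+α} for all u, u+δ ∈ V and all ξ ∈ X. Then there exists a map F : X → Y which is n times continuously Fréchet differentiable, whose n-th Fréchet derivative is globally α-Hölder continuous on X, and such that J^n_ξ F(u) = P(ξ, u) for all u ∈ V and all ξ ∈ X. -/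
open scoped BigOperators

namespace WhitneyExtension

open Set Metric Filter Topology
open scoped ContDiff ENNReal NNReal

section PolynomialMaps

variable {E F : Type*} [NormedAddCommGroup E] [NormedSpace ℝ E]
  [NormedAddCommGroup F] [NormedSpace ℝ F]

/-- `Q` is a continuous polynomial map of degree `< N`. -/
def IsPolyMap (N : ℕ) (Q : E → F) : Prop :=
  ∀ x, ∃ p : FormalMultilinearSeries ℝ E F, HasFiniteFPowerSeriesOnBall Q p x N ⊤

theorem IsPolyMap.of_hasFiniteFPowerSeriesOnBall {N : ℕ} {Q : E → F}
    {p : FormalMultilinearSeries ℝ E F} {x : E} (h : HasFiniteFPowerSeriesOnBall Q p x N ⊤) :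
    IsPolyMap N Q := by
  intro y
  have := h.changeOrigin (y := y - x) (by simp)
  rw [add_sub_cancel] at this
  exact ⟨_, by simpa using this⟩

theorem IsPolyMap.sub {N : ℕ} {Q R : E → F} (hQ : IsPolyMap N Q) (hR : IsPolyMap N R) :
    IsPolyMap N (fun x => Q x - R x) := by
  intro x
  obtain ⟨p, hp⟩ := hQ x
  obtain ⟨q, hq⟩ := hR x
  have := hp.sub hq
  rw [max_self] at this
  exact ⟨_, this⟩

theorem IsPolyMap.contDiff {N : ℕ} {Q : E → F} (hQ : IsPolyMap N Q) {k : ℕ∞ω} :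
    ContDiff ℝ k Q := by
  refine contDiff_iff_contDiffAt.2 fun x => ?_
  obtain ⟨p, hp⟩ := hQ x
  exact hp.cpolynomialAt.contDiffAt

theorem IsPolyMap.fderiv {N : ℕ} {Q : E → F} (hQ : IsPolyMap N Q) :
    IsPolyMap (N - 1) (fderiv ℝ Q) := by
  intro x
  obtain ⟨p, hp⟩ := hQ x
  exact ⟨_, hp.fderiv'⟩

theorem IsPolyMap.iteratedFDeriv {N : ℕ} {Q : E → F} (hQ : IsPolyMap N Q) (k : ℕ) :
    IsPolyMap (N - k) (iteratedFDeriv ℝ k Q) := by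
  induction k with
  | zero =>
    intro x
    obtain ⟨p, hp⟩ := hQ x
    exact ⟨_, ((continuousMultilinearCurryFin0 ℝ E F).symm :
      F →L[ℝ] E [×0]→L[ℝ] F).comp_hasFiniteFPowerSeriesOnBall hp⟩
  | succ k ih =>
    intro x
    obtain ⟨p, hp⟩ := ih.fderiv x
    rw [Nat.sub_sub] at hp
    rw [iteratedFDeriv_succ_eq_comp_left]
    exact ⟨_, ContinuousLinearMap.comp_hasFiniteFPowerSeriesOnBall
      ((continuousMultilinearCurryLeftEquiv ℝ (fun _ : Fin (k + 1) => E)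
        F).symm.toContinuousLinearEquiv.toContinuousLinearMap) hp⟩

theorem IsPolyMap.eq_zero {Q : E → F} (hQ : IsPolyMap 0 Q) (x : E) : Q x = 0 := by
  obtain ⟨p, hp⟩ := hQ x
  exact hp.eq_zero_of_bound_zero x (by simp)

theorem IsPolyMap.iteratedFDeriv_eq_zero {N : ℕ} {Q : E → F} (hQ : IsPolyMap N Q) (x : E) :
    _root_.iteratedFDeriv ℝ N Q x = 0 := by
  have := hQ.iteratedFDeriv N
  rw [Nat.sub_self] at this
  exact this.eq_zero x

theorem IsPolyMap.iteratedFDeriv_eq_const {n : ℕ} {Q : E → F} (hQ : IsPolyMap (n + 1) Q)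
    (x y : E) : _root_.iteratedFDeriv ℝ n Q x = _root_.iteratedFDeriv ℝ n Q y := by
  refine is_const_of_fderiv_eq_zero (𝕜 := ℝ) (hQ.iteratedFDeriv n).contDiff.differentiable_one
    (fun z => ?_) x y
  rw [← norm_eq_zero, norm_fderiv_iteratedFDeriv, hQ.iteratedFDeriv_eq_zero, norm_zero]

theorem IsPolyMap.taylor [CompleteSpace F] {N : ℕ} {Q : E → F} (hQ : IsPolyMap N Q) (x y : E) :
    ∑ m ∈ Finset.range N,
      (m.factorial : ℝ)⁻¹ • _root_.iteratedFDeriv ℝ m Q x (fun _ => y) = Q (x + y) := by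
  obtain ⟨p, hp⟩ := hQ x
  refine HasSum.unique ?_ (hp.toHasFPowerSeriesOnBall.hasSum_iteratedFDeriv (y := y) (by simp))
  refine hasSum_sum_of_ne_finset_zero fun m hm => ?_
  rw [Finset.mem_range, not_lt] at hm
  rw [← hp.toHasFPowerSeriesOnBall.factorial_smul, hp.finite m hm]
  simp

/-- Nodes in `[0, 1]` and weights computing the derivative at `0` of polynomials of
degree `< N`. -/
theorem exists_derivative_weights (N : ℕ) : ∃ t w : Fin N → ℝ, (∀ j, |t j| ≤ 1) ∧
    ∀ k < N, ∑ j, w j * t j ^ k = if k = 1 then 1 else 0 := by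
  let t : Fin N → ℝ := fun j => (j : ℝ) / N
  have ht : Function.Injective t := by
    intro i j hij
    have hN : (N : ℝ) ≠ 0 := by have := i.pos; positivity
    have : (i : ℝ) = j := by simpa [t, div_left_inj' hN] using hij
    exact Fin.ext (by exact_mod_cast this)
  have hdet : IsUnit (Matrix.vandermonde t).det :=
    (Matrix.det_vandermonde_ne_zero_iff.2 ht).isUnit
  refine ⟨t, Matrix.vecMul (fun k : Fin N => if (k : ℕ) = 1 then 1 else 0)
    (Matrix.vandermonde t)⁻¹, fun j => ?_, fun k hk => ?_⟩
  · have h1 : (j : ℝ) ≤ N := by exact_mod_cast j.2.le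
    rw [abs_of_nonneg (by positivity)]
    exact div_le_one_of_le₀ h1 (by positivity)
  · have := congrFun (Matrix.vecMul_vecMul (fun k : Fin N => if (k : ℕ) = 1 then (1 : ℝ) else 0)
      (Matrix.vandermonde t)⁻¹ (Matrix.vandermonde t)) ⟨k, hk⟩
    rw [Matrix.nonsing_inv_mul _ hdet, Matrix.vecMul_one] at this
    simpa [Matrix.vecMul, dotProduct, Matrix.vandermonde_apply] using this

theorem IsPolyMap.fderiv_apply_eq_sum {N : ℕ} {t w : Fin N → ℝ}
    (hw : ∀ k < N, ∑ j, w j * t j ^ k = if k = 1 then 1 else 0)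
    {Q : E → F} (hQ : IsPolyMap N Q) (x h : E) :
    _root_.fderiv ℝ Q x h = ∑ j, w j • Q (x + t j • h) := by
  obtain ⟨p, hp⟩ := hQ x
  have hQp : ∀ s : ℝ, Q (x + s • h) = ∑ k ∈ Finset.range N, s ^ k • p k fun _ => h := by
    intro s
    rw [hp.eq_partialSum' _ (by simp) N le_rfl, FormalMultilinearSeries.partialSum]
    refine Finset.sum_congr rfl fun k _ => ?_
    rw [add_sub_cancel_left, (p k).map_smul_univ (fun _ => s) (fun _ => h)]
    simp
  have h1 : _root_.fderiv ℝ Q x h = p 1 fun _ => h := by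
    rw [hp.toHasFPowerSeriesOnBall.hasFPowerSeriesAt.hasFDerivAt.fderiv]
    simp only [continuousMultilinearCurryFin1_apply]
    congr 1
  simp_rw [hQp, Finset.smul_sum, smul_smul]
  rw [Finset.sum_comm, h1]
  simp_rw [← Finset.sum_smul]
  rw [Finset.sum_congr rfl (g := fun k => if k = 1 then p 1 (fun _ => h) else 0)]
  · rw [Finset.sum_ite_eq']
    split_ifs with h2
    · rfl
    · rw [hp.finite 1 (by simpa using h2)]; simp
  · intro k hk
    rw [hw k (Finset.mem_range.1 hk)]
    split_ifs with h2
    · subst h2; simp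
    · simp

theorem IsPolyMap.norm_fderiv_le {N : ℕ} {t w : Fin N → ℝ} (ht : ∀ j, |t j| ≤ 1)
    (hw : ∀ k < N, ∑ j, w j * t j ^ k = if k = 1 then 1 else 0)
    {Q : E → F} (hQ : IsPolyMap N Q) {x : E} {ρ M : ℝ} (hρ : 0 < ρ) (hM : 0 ≤ M)
    (hQM : ∀ h : E, ‖h‖ ≤ ρ → ‖Q (x + h)‖ ≤ M) :
    ‖_root_.fderiv ℝ Q x‖ ≤ (∑ j, |w j|) * (M / ρ) := by
  have hW : 0 ≤ ∑ j, |w j| := Finset.sum_nonneg fun _ _ => abs_nonneg _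
  refine ContinuousLinearMap.opNorm_le_bound _ (by positivity) fun h => ?_
  rcases eq_or_ne h 0 with rfl | hh
  · simp
  have hh' : 0 < ‖h‖ := norm_pos_iff.2 hh
  have key : ‖_root_.fderiv ℝ Q x ((ρ / ‖h‖) • h)‖ ≤ (∑ j, |w j|) * M := by
    rw [hQ.fderiv_apply_eq_sum hw, Finset.sum_mul]
    refine norm_sum_le_of_le _ fun j _ => ?_
    rw [norm_smul, Real.norm_eq_abs]
    refine mul_le_mul_of_nonneg_left (hQM _ ?_) (abs_nonneg _)
    rw [norm_smul, norm_smul, norm_div, norm_norm, Real.norm_of_nonneg hρ.le,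
      div_mul_cancel₀ _ hh'.ne', Real.norm_eq_abs]
    nlinarith [ht j]
  rw [map_smul, norm_smul, norm_div, norm_norm, Real.norm_of_nonneg hρ.le, div_mul_eq_mul_div,
    div_le_iff₀ hh'] at key
  rw [← mul_div_assoc, div_mul_eq_mul_div, le_div_iff₀ hρ]
  linarith

theorem rpow_le_mul_rpow_of_comparable {a s u : ℝ} (γ : ℝ) (ha : 1 ≤ a) (hs : 0 < s)
    (h₁ : s / a ≤ u) (h₂ : u ≤ a * s) : u ^ γ ≤ a ^ |γ| * s ^ γ := by
  have ha0 : 0 < a := by linarith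
  have hu : 0 < u := (div_pos hs ha0).trans_le h₁
  rcases le_total 0 γ with hγ | hγ
  · rw [abs_of_nonneg hγ, ← Real.mul_rpow ha0.le hs.le]
    exact Real.rpow_le_rpow hu.le h₂ hγ
  · rw [abs_of_nonpos hγ, Real.rpow_neg ha0.le, ← div_eq_inv_mul, ← Real.div_rpow hs.le ha0.le]
    exact Real.rpow_le_rpow_of_nonpos (div_pos hs ha0) h₁ hγ

variable (E F) in
/-- **Markov's inequality** for the derivatives of a polynomial map of polynomial growth. -/
theorem exists_norm_iteratedFDeriv_le (N : ℕ) (β : ℝ) : ∃ W : ℝ, 1 ≤ W ∧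
    ∀ {Q : E → F}, IsPolyMap N Q → ∀ {A r : ℝ} {v : E}, 0 ≤ A → 0 < r →
      (∀ x, ‖Q x‖ ≤ A * (‖x - v‖ + r) ^ β) → ∀ k ≤ N, ∀ x : E,
        ‖_root_.iteratedFDeriv ℝ k Q x‖ ≤ A * W * (‖x - v‖ + r) ^ (β - k) := by
  have hw' : ∀ k : ℕ, ∃ t w : Fin (N - k) → ℝ, (∀ j, |t j| ≤ 1) ∧
    ∀ i < N - k, ∑ j, w j * t j ^ i = if i = 1 then 1 else 0 := fun k =>
    exists_derivative_weights (N - k)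
  choose t w ht hw using hw'
  have main : ∀ k : ℕ, ∃ W : ℝ, 1 ≤ W ∧
    ∀ {Q : E → F}, IsPolyMap N Q → ∀ {A r : ℝ} {v : E}, 0 ≤ A → 0 < r →
      (∀ x, ‖Q x‖ ≤ A * (‖x - v‖ + r) ^ β) → ∀ x : E,
        ‖_root_.iteratedFDeriv ℝ k Q x‖ ≤ A * W * (‖x - v‖ + r) ^ (β - k) := by
    intro k
    induction k with
    | zero =>
      refine ⟨1, le_rfl, fun {Q} hQ {A r v} hA hr h x => ?_⟩
      simpa using h x
    | succ k ih =>
      obtain ⟨W, hW, ih⟩ := ih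
      refine ⟨max 1 ((∑ j, |w k j|) * (W * 2 ^ |β - k| * 2)), le_max_left _ _,
        fun {Q} hQ {A r v} hA hr h x => ?_⟩
      have hs : 0 < ‖x - v‖ + r := by positivity
      set s := ‖x - v‖ + r with hs_def
      rw [← norm_fderiv_iteratedFDeriv]
      refine ((hQ.iteratedFDeriv k).norm_fderiv_le (ht k) (hw k) (half_pos hs)
        (M := A * W * (2 ^ |β - k| * s ^ (β - k))) (by positivity) fun y hy => ?_).trans ?_
      · refine (ih hQ hA hr h (x + y)).trans ?_
        refine mul_le_mul_of_nonneg_left ?_ (by positivity)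
        have e : x + y - v = (x - v) + y := by abel
        refine rpow_le_mul_rpow_of_comparable _ one_le_two hs ?_ ?_
        · have := norm_sub_le_norm_add (x - v) y
          rw [e]; linarith
        · have := norm_add_le (x - v) y
          rw [e]; linarith
      · have e : s ^ (β - (k + 1 : ℕ)) = s ^ (β - k) / s := by
          rw [Nat.cast_add, Nat.cast_one, ← sub_sub, Real.rpow_sub_one hs.ne']
        have e' : (∑ j, |w k j|) * (A * W * (2 ^ |β - k| * s ^ (β - k)) / (s / 2)) =
            A * ((∑ j, |w k j|) * (W * 2 ^ |β - k| * 2)) * (s ^ (β - k) / s) := by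
          field_simp
        rw [e, e']
        gcongr
        exact le_max_right _ _
  choose W hW1 hW using main
  refine ⟨∑ k ∈ Finset.range (N + 1), W k, ?_, fun {Q} hQ {A r v} hA hr h k hk x => ?_⟩
  · refine (hW1 0).trans (Finset.single_le_sum (f := W) (fun k _ => zero_le_one.trans (hW1 k)) ?_)
    simp
  · refine (hW k hQ hA hr h x).trans ?_
    gcongr
    refine Finset.single_le_sum (f := W) (fun k _ => zero_le_one.trans (hW1 k)) ?_
    simpa [Nat.lt_succ_iff] using hk

end PolynomialMaps

section Partition

variable {X : Type*} [NormedAddCommGroup X]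

theorem infDist_le_infDist_add_norm (V : Set X) (x y : X) :
    infDist x V ≤ infDist y V + ‖x - y‖ := by
  rw [← dist_eq_norm]
  exact infDist_le_infDist_add_dist

/-- A maximal family of points off `V`, separated on the scale of their distance to `V`. -/
theorem exists_whitney_net (V : Set X) : ∃ S : Set X, (∀ s ∈ S, 0 < infDist s V) ∧
    (S.Pairwise fun s t => infDist s V / 8 ≤ ‖s - t‖) ∧
    ∀ x, 0 < infDist x V → ∃ s ∈ S, ‖x - s‖ ≤ infDist s V / 4 := by
  obtain ⟨S, hS⟩ := zorn_subset {S : Set X | (∀ s ∈ S, 0 < infDist s V) ∧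
    S.Pairwise fun s t => infDist s V / 8 ≤ ‖s - t‖} (by
      intro c hc hchain
      refine ⟨⋃₀ c, ⟨?_, ?_⟩, fun s hs => subset_sUnion_of_mem hs⟩
      · rintro s ⟨T, hT, hs⟩
        exact (hc hT).1 s hs
      · exact (pairwise_sUnion hchain.directedOn).2 fun T hT => (hc hT).2)
  refine ⟨S, hS.prop.1, hS.prop.2, fun x hx => ?_⟩
  by_contra! hcon
  have hmem : x ∈ S := by
    refine hS.le_of_ge (y := insert x S) ⟨?_, ?_⟩ (subset_insert _ _) (mem_insert _ _)
    · rintro s (rfl | hs)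
      · exact hx
      · exact hS.prop.1 s hs
    · refine hS.prop.2.insert fun s hs _ => ⟨?_, ?_⟩
      · have h1 := hcon s hs
        have h2 := infDist_le_infDist_add_norm V x s
        linarith [norm_nonneg (x - s)]
      · have h1 := hcon s hs
        have h2 := hS.prop.1 s hs
        rw [norm_sub_rev]
        linarith
  have := hcon x hmem
  simp at this
  linarith

variable [NormedSpace ℝ X]

theorem norm_iteratedFDeriv_smul_le_of_scaled {Y : Type*} [NormedAddCommGroup Y]
    [NormedSpace ℝ Y] {f : X → ℝ} {g : X → Y} (hf : ContDiff ℝ ∞ f) (hg : ContDiff ℝ ∞ g)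
    {x : X} {d M₁ M₂ β : ℝ} (hd : 0 < d) (hM₁ : 0 ≤ M₁) {k : ℕ}
    (hf' : ∀ j ≤ k, ‖iteratedFDeriv ℝ j f x‖ ≤ M₁ * d ^ (-(j : ℝ)))
    (hg' : ∀ j ≤ k, ‖iteratedFDeriv ℝ j g x‖ ≤ M₂ * d ^ (β - j)) :
    ‖iteratedFDeriv ℝ k (fun y => f y • g y) x‖ ≤ 2 ^ k * M₁ * M₂ * d ^ (β - k) := by
  refine (norm_iteratedFDeriv_smul_le hf hg x (mod_cast le_top)).trans ?_
  have h2 : (2 : ℝ) ^ k = ∑ j ∈ Finset.range (k + 1), (k.choose j : ℝ) := by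
    exact_mod_cast (Nat.sum_range_choose k).symm
  rw [h2, Finset.sum_mul, Finset.sum_mul, Finset.sum_mul]
  refine Finset.sum_le_sum fun j hj => ?_
  have hjk : j ≤ k := Nat.lt_succ_iff.1 (Finset.mem_range.1 hj)
  have e : d ^ (β - k) = d ^ (-(j : ℝ)) * d ^ (β - (k - j : ℕ)) := by
    rw [← Real.rpow_add hd, Nat.cast_sub hjk]
    congr 1
    ring
  calc (k.choose j : ℝ) * ‖iteratedFDeriv ℝ j f x‖ * ‖iteratedFDeriv ℝ (k - j) g x‖
      ≤ (k.choose j : ℝ) * (M₁ * d ^ (-(j : ℝ))) * (M₂ * d ^ (β - (k - j : ℕ))) := by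
        gcongr
        · exact hf' j hjk
        · exact hg' _ (Nat.sub_le _ _)
    _ = _ := by rw [e]; ring

variable (X) in
theorem exists_packing_bound [FiniteDimensional ℝ X] : ∃ N : ℕ, ∀ (x : X) (d : ℝ), 0 < d →
    ∀ A : Set X, (∀ s ∈ A, ‖s - x‖ ≤ 2 * d) → (A.Pairwise fun s t => d / 24 ≤ ‖s - t‖) →
      A.Finite ∧ A.ncard ≤ N := by
  obtain ⟨t, ht, hcov⟩ := totallyBounded_iff.1
    (isCompact_closedBall (0 : X) 2).totallyBounded (1 / 48) (by norm_num)
  refine ⟨t.ncard, fun x d hd A hA hsep => ?_⟩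
  have hex : ∀ s : X, ∃ y : X, s ∈ A → y ∈ t ∧ ‖d⁻¹ • (s - x) - y‖ < 1 / 48 := by
    intro s
    by_cases hs : s ∈ A
    · have : d⁻¹ • (s - x) ∈ closedBall (0 : X) 2 := by
        rw [mem_closedBall_zero_iff, norm_smul, norm_inv, Real.norm_of_nonneg hd.le,
          inv_mul_le_iff₀ hd, mul_comm]
        exact hA s hs
      obtain ⟨y, hy, hy'⟩ := mem_iUnion₂.1 (hcov this)
      exact ⟨y, fun _ => ⟨hy, by rwa [mem_ball, dist_eq_norm] at hy'⟩⟩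
    · exact ⟨0, fun h => absurd h hs⟩
  choose f hf using hex
  have hmaps : MapsTo f A t := fun s hs => (hf s hs).1
  have hinj : InjOn f A := by
    intro s hs s' hs' hss'
    by_contra hne
    have h1 := (hf s hs).2
    have h2 := (hf s' hs').2
    rw [← hss'] at h2
    have h3 : ‖d⁻¹ • (s - s')‖ < 1 / 24 := by
      have e : d⁻¹ • (s - s') = (d⁻¹ • (s - x) - f s) - (d⁻¹ • (s' - x) - f s) := by
        rw [sub_sub_sub_cancel_right, ← smul_sub, sub_sub_sub_cancel_right]
      rw [e]
      exact (norm_sub_le _ _).trans_lt (by linarith)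
    rw [norm_smul, norm_inv, Real.norm_of_nonneg hd.le, inv_mul_lt_iff₀ hd] at h3
    have := hsep hs hs' hne
    linarith
  exact ⟨Set.Finite.of_injOn hmaps hinj ht, ncard_le_ncard_of_injOn f hmaps hinj ht⟩

theorem exists_contDiff_eq_inv : ∃ g : ℝ → ℝ, ContDiff ℝ ∞ g ∧ ∀ t, 1 ≤ t → g t = t⁻¹ := by
  refine ⟨fun t => Real.smoothTransition (2 * t - 1) * t⁻¹, ?_, fun t ht => ?_⟩
  · refine contDiff_iff_contDiffAt.2 fun t => ?_
    rcases eq_or_ne t 0 with rfl | ht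
    · refine (contDiffAt_const (c := (0 : ℝ))).congr_of_eventuallyEq ?_
      filter_upwards [Iio_mem_nhds (show (0 : ℝ) < 1 / 2 by norm_num)] with t ht
      rw [Real.smoothTransition.zero_of_nonpos (by linarith [mem_Iio.1 ht]), zero_mul]
    · refine ContDiffAt.mul ?_ (contDiffAt_inv ℝ ht)
      exact (Real.smoothTransition.contDiff.comp (by fun_prop)).contDiffAt
  · simp only
    rw [Real.smoothTransition.one_of_one_le (by linarith), one_mul]

theorem exists_iteratedFDeriv_bound_Icc {g : ℝ → ℝ} (hg : ContDiff ℝ ∞ g) (m : ℕ) (a b : ℝ) :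
    ∃ G : ℝ, 0 ≤ G ∧ ∀ k ≤ m, ∀ t ∈ Icc a b, ‖iteratedFDeriv ℝ k g t‖ ≤ G := by
  have h : ∀ k : ℕ, ∃ G : ℝ, ∀ t ∈ Icc a b, ‖iteratedFDeriv ℝ k g t‖ ≤ G := fun k =>
    isCompact_Icc.exists_bound_of_continuousOn
      (hg.continuous_iteratedFDeriv (m := k) (mod_cast le_top)).continuousOn
  choose G hG using h
  refine ⟨∑ k ∈ Finset.range (m + 1), |G k|, Finset.sum_nonneg fun _ _ => abs_nonneg _,
    fun k hk t ht => ((hG k t ht).trans (le_abs_self _)).trans ?_⟩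
  exact Finset.single_le_sum (f := fun k => |G k|) (fun _ _ => abs_nonneg _)
    (Finset.mem_range.2 (Nat.lt_succ_iff.2 hk))

/-- A smooth bump with uniform bounds on the derivatives of all its rescalings. -/
theorem exists_bump [FiniteDimensional ℝ X] (m : ℕ) : ∃ (b : X → ℝ) (B : ℝ), 0 ≤ B ∧
    ContDiff ℝ ∞ b ∧ (∀ x, 0 ≤ b x) ∧ (∀ x, b x ≤ 1) ∧ (∀ x, ‖x‖ ≤ 1 / 4 → b x = 1) ∧
    (∀ x, 1 / 2 ≤ ‖x‖ → b x = 0) ∧ ∀ k ≤ m, ∀ (r : ℝ) (_ : 0 < r) (s x : X),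
      ‖iteratedFDeriv ℝ k (fun y => b (r⁻¹ • (y - s))) x‖ ≤ B * r⁻¹ ^ k := by
  let b : ContDiffBump (0 : X) := ⟨1 / 4, 1 / 2, by norm_num, by norm_num⟩
  have hb : ContDiff ℝ ∞ b := b.contDiff
  have h : ∀ k : ℕ, ∃ B : ℝ, ∀ x, ‖iteratedFDeriv ℝ k b x‖ ≤ B := fun k =>
    (b.hasCompactSupport.iteratedFDeriv (𝕜 := ℝ) k).exists_bound_of_continuous
      (hb.continuous_iteratedFDeriv (m := k) (mod_cast le_top))
  choose B hB using h
  refine ⟨b, ∑ k ∈ Finset.range (m + 1), |B k|, Finset.sum_nonneg fun _ _ => abs_nonneg _,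
    hb, fun x => b.nonneg, fun x => b.le_one, fun x hx => ?_, fun x hx => ?_,
    fun k hk r hr s x => ?_⟩
  · exact b.one_of_mem_closedBall (mem_closedBall_zero_iff.2 hx)
  · exact b.zero_of_le_dist (by simpa [b] using hx)
  · rw [iteratedFDeriv_comp_sub (f := fun z => b (r⁻¹ • z)),
      iteratedFDeriv_comp_const_smul _ (hb.of_le (mod_cast le_top)), norm_smul, norm_pow, norm_inv,
      Real.norm_of_nonneg hr.le, mul_comm]
    refine mul_le_mul_of_nonneg_right (((hB k _).trans (le_abs_self _)).trans ?_) (by positivity)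
    exact Finset.single_le_sum (f := fun k => |B k|) (fun _ _ => abs_nonneg _)
      (Finset.mem_range.2 (Nat.lt_succ_iff.2 hk))

theorem exists_whitney_partition [FiniteDimensional ℝ X] (V : Set X) (m : ℕ) :
    ∃ (S : Set X) (φ : S → X → ℝ) (N : ℕ) (M : ℝ), 0 ≤ M ∧ (∀ i, ContDiff ℝ ∞ (φ i)) ∧
      ∀ x, 0 < infDist x V → ∃ A : Finset S, A.card ≤ N ∧
        (∀ i ∈ A, ‖x - (i : X)‖ ≤ 2 * infDist x V ∧ infDist (i : X) V ≤ 3 * infDist x V) ∧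
        (∀ᶠ y in 𝓝 x, ∀ i ∉ A, φ i y = 0) ∧ (∀ᶠ y in 𝓝 x, ∑ i ∈ A, φ i y = 1) ∧
        ∀ i ∈ A, ∀ k ≤ m, ‖iteratedFDeriv ℝ k (φ i) x‖ ≤ M * infDist x V ^ (-(k : ℝ)) := by
  obtain ⟨S, hSpos, hSsep, hScov⟩ := exists_whitney_net V
  obtain ⟨N, hN⟩ := exists_packing_bound X
  obtain ⟨b, B, hB, hb, hb0, hb1, hbone, hbzero, hbder⟩ := exists_bump (X := X) m
  obtain ⟨g, hg, hginv⟩ := exists_contDiff_eq_inv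
  obtain ⟨G, hG, hGb⟩ := exists_iteratedFDeriv_bound_Icc hg m 1 N
  let ψ : S → X → ℝ := fun i x => b ((infDist (i : X) V)⁻¹ • (x - i))
  have hψ : ∀ i, ContDiff ℝ ∞ (ψ i) := fun i => hb.comp (by fun_prop)
  have hψone : ∀ (i : S) (x : X), ‖x - (i : X)‖ ≤ infDist (i : X) V / 4 → ψ i x = 1 := by
    intro i x hx
    have := hSpos i i.2
    refine hbone _ ?_
    rw [norm_smul, norm_inv, Real.norm_of_nonneg this.le, inv_mul_le_iff₀ this]
    linarith
  have hψzero : ∀ (i : S) (x : X), infDist (i : X) V / 2 ≤ ‖x - (i : X)‖ → ψ i x = 0 := by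
    intro i x hx
    have := hSpos i i.2
    refine hbzero _ ?_
    rw [norm_smul, norm_inv, Real.norm_of_nonneg this.le, le_inv_mul_iff₀ this]
    linarith
  let Ψ : X → ℝ := fun x => ∑ᶠ i, ψ i x
  have hloc : ∀ x, 0 < infDist x V → ∃ A : Finset S, A.card ≤ N ∧
      (∀ i ∈ A, ‖x - (i : X)‖ ≤ 2 * infDist x V ∧ infDist (i : X) V ≤ 3 * infDist x V ∧
        infDist x V / 3 ≤ infDist (i : X) V) ∧
      ∀ᶠ y in 𝓝 x, 0 < infDist y V ∧ ∀ i ∉ A, ψ i y = 0 := by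
    intro x hx
    set d := infDist x V with hd
    obtain ⟨hfin, hcard⟩ := hN x d hx
      {s | s ∈ S ∧ ‖x - s‖ ≤ 2 * d ∧ infDist s V ≤ 3 * d ∧ d / 3 ≤ infDist s V}
      (fun s hs => by rw [norm_sub_rev]; exact hs.2.1)
      (fun s hs t ht hst => by linarith [hSsep hs.1 ht.1 hst, hs.2.2.2])
    have hfin' : {i : S | ‖x - (i : X)‖ ≤ 2 * d ∧ infDist (i : X) V ≤ 3 * d ∧
        d / 3 ≤ infDist (i : X) V}.Finite :=
      (hfin.preimage Subtype.val_injective.injOn).subset fun i hi => ⟨i.2, hi⟩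
    refine ⟨hfin'.toFinset, ?_, fun i hi => by simpa using hi, ?_⟩
    · rw [← ncard_eq_toFinset_card _ hfin']
      refine le_trans ?_ hcard
      exact ncard_le_ncard_of_injOn Subtype.val (fun i hi => ⟨i.2, hi⟩)
        Subtype.val_injective.injOn hfin
    · filter_upwards [ball_mem_nhds x (half_pos hx)] with y hy
      rw [mem_ball, dist_eq_norm] at hy
      have hxy := infDist_le_infDist_add_norm V x y
      have hyx := infDist_le_infDist_add_norm V y x
      have hr := norm_sub_rev x y
      refine ⟨by linarith, fun i hi => ?_⟩
      by_contra hne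
      have hlt : ‖y - (i : X)‖ < infDist (i : X) V / 2 := by
        by_contra! hle
        exact hne (hψzero i y hle)
      have hiy := infDist_le_infDist_add_norm V (i : X) y
      have hyi := infDist_le_infDist_add_norm V y i
      have hr' := norm_sub_rev y (i : X)
      have hxi : ‖x - (i : X)‖ ≤ ‖x - y‖ + ‖y - (i : X)‖ := norm_sub_le_norm_sub_add_norm_sub _ _ _
      refine hi ?_
      simp only [Set.Finite.mem_toFinset, mem_ofPred_eq]
      refine ⟨by linarith, by linarith, by linarith⟩
  have hΨsum : ∀ (A : Finset S) y, (∀ i ∉ A, ψ i y = 0) → Ψ y = ∑ i ∈ A, ψ i y := by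
    intro A y h
    refine finsum_eq_sum_of_support_subset _ fun i hi => ?_
    by_contra hiA
    exact hi (h i hiA)
  have hΨone : ∀ (A : Finset S) y, 0 < infDist y V → (∀ i ∉ A, ψ i y = 0) → 1 ≤ Ψ y := by
    intro A y hy h
    obtain ⟨s, hs, hys⟩ := hScov y hy
    rw [hΨsum A y h, ← hψone ⟨s, hs⟩ y hys]
    refine Finset.single_le_sum (f := fun i => ψ i y) (fun _ _ => hb0 _) ?_
    by_contra hsA
    have := h _ hsA
    rw [hψone ⟨s, hs⟩ y hys] at this
    exact one_ne_zero this
  have hφloc : ∀ (A : Finset S) x, (∀ᶠ y in 𝓝 x, 0 < infDist y V ∧ ∀ i ∉ A, ψ i y = 0) →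
      ∀ i, (fun y => g (Ψ y) • ψ i y) =ᶠ[𝓝 x] fun y => g (∑ j ∈ A, ψ j y) • ψ i y := by
    intro A x h i
    filter_upwards [h] with y hy
    rw [hΨsum A y hy.2]
  have hgA : ∀ A : Finset S, ContDiff ℝ ∞ fun y => g (∑ j ∈ A, ψ j y) := fun A =>
    hg.comp (ContDiff.sum fun j _ => hψ j)
  refine ⟨S, fun i y => g (Ψ y) • ψ i y, N,
    2 ^ m * (m.factorial * G * (3 * (1 + N * B)) ^ m) * (B * 3 ^ m), by positivity,
    fun i => contDiff_iff_contDiffAt.2 fun x => ?_, fun x hx => ?_⟩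
  · rcases (infDist_nonneg (x := x) (s := V)).eq_or_lt with hx | hx
    · refine (contDiffAt_const (c := (0 : ℝ))).congr_of_eventuallyEq ?_
      have hi := hSpos i i.2
      have hix := infDist_le_infDist_add_norm V (i : X) x
      have hr := norm_sub_rev x (i : X)
      have : {y : X | infDist (i : X) V / 2 < ‖y - (i : X)‖} ∈ 𝓝 x :=
        (isOpen_lt continuous_const (by fun_prop)).mem_nhds
          (show infDist (i : X) V / 2 < ‖x - (i : X)‖ by linarith)
      filter_upwards [this] with y hy
      rw [hψzero i y (le_of_lt hy), smul_zero]
    · obtain ⟨A, -, -, hA⟩ := hloc x hx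
      exact ((hgA A).smul (hψ i)).contDiffAt.congr_of_eventuallyEq (hφloc A x hA i)
  · obtain ⟨A, hAN, hAx, hA⟩ := hloc x hx
    refine ⟨A, hAN, fun i hi => ⟨(hAx i hi).1, (hAx i hi).2.1⟩, ?_, ?_, ?_⟩
    · filter_upwards [hA] with y hy i hi
      rw [hy.2 i hi, smul_zero]
    · filter_upwards [hA] with y hy
      have h1 := hΨone A y hy.1 hy.2
      rw [← Finset.smul_sum, ← hΨsum A y hy.2, hginv _ h1, smul_eq_mul]
      exact inv_mul_cancel₀ (by linarith)
    · intro i hi k hk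
      set d := infDist x V with hd
      have hψd : ∀ j ∈ A, ∀ k ≤ m, ‖iteratedFDeriv ℝ k (ψ j) x‖ ≤ B * (3 / d) ^ k := by
        intro j hj k hk
        refine (hbder k hk _ (hSpos j j.2) j x).trans ?_
        have h3 := (hAx j hj).2.2
        have h4 : (infDist (j : X) V)⁻¹ ≤ 3 / d := by
          rw [inv_le_comm₀ (hSpos j j.2) (by positivity), inv_div]
          exact h3
        have h5 : 0 ≤ (infDist (j : X) V)⁻¹ := inv_nonneg.2 infDist_nonneg
        gcongr
      have hpow : ∀ j : ℕ, (1 / d) ^ j = d ^ (-(j : ℝ)) := by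
        intro j
        rw [Real.rpow_neg hx.le, Real.rpow_natCast, one_div, inv_pow]
      have hN0 : (0 : ℝ) ≤ N * B := by positivity
      have hsum : ∀ k, 1 ≤ k → k ≤ m →
          ‖iteratedFDeriv ℝ k (fun y => ∑ j ∈ A, ψ j y) x‖ ≤ (3 * (1 + N * B) / d) ^ k := by
        intro k hk1 hk
        rw [iteratedFDeriv_fun_sum_apply fun j _ => (hψ j).contDiffAt.of_le (mod_cast le_top)]
        calc ‖∑ j ∈ A, iteratedFDeriv ℝ k (ψ j) x‖ ≤ ∑ j ∈ A, B * (3 / d) ^ k :=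
              norm_sum_le_of_le _ fun j hj => hψd j hj k hk
          _ = A.card * B * (3 / d) ^ k := by rw [Finset.sum_const, nsmul_eq_mul, mul_assoc]
          _ ≤ (1 + N * B) ^ k * (3 / d) ^ k := by
              have h1 : (A.card : ℝ) ≤ N := by exact_mod_cast hAN
              have h2 : 1 + N * B ≤ (1 + N * B) ^ k :=
                le_self_pow₀ (by linarith) (by omega)
              have h3 : A.card * B ≤ N * B := by gcongr
              gcongr
              linarith
          _ = _ := by rw [← mul_pow]; ring
      have hIcc : ∑ j ∈ A, ψ j x ∈ Icc (1 : ℝ) N := by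
        constructor
        · rw [← hΨsum A x hA.self_of_nhds.2]
          exact hΨone A x hx hA.self_of_nhds.2
        · calc ∑ j ∈ A, ψ j x ≤ ∑ j ∈ A, (1 : ℝ) := Finset.sum_le_sum fun j _ => hb1 _
            _ = A.card := by simp
            _ ≤ N := by exact_mod_cast hAN
      have hgd : ∀ k ≤ m, ‖iteratedFDeriv ℝ k (fun y => g (∑ j ∈ A, ψ j y)) x‖ ≤
          m.factorial * G * (3 * (1 + N * B)) ^ m * d ^ (-(k : ℝ)) := by
        intro k hk
        refine (norm_iteratedFDeriv_comp_le hg (ContDiff.sum fun j _ => hψ j) (mod_cast le_top) x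
          (fun j hj => hGb j (hj.trans hk) _ hIcc)
          (fun j hj1 hj => hsum j hj1 (hj.trans hk))).trans ?_
        have h1 : (k.factorial : ℝ) ≤ m.factorial := by exact_mod_cast Nat.factorial_le hk
        have h2 : (3 * (1 + N * B)) ^ k ≤ (3 * (1 + N * B)) ^ m :=
          pow_le_pow_right₀ (by linarith) hk
        rw [div_eq_mul_one_div, mul_pow, hpow, ← mul_assoc]
        gcongr
      rw [((hφloc A x hA i).iteratedFDeriv ℝ k).eq_of_nhds]
      refine (norm_iteratedFDeriv_smul_le_of_scaled (hgA A) (hψ i) hx (by positivity)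
        (M₂ := B * 3 ^ m) (β := 0) (fun j hj => hgd j (hj.trans hk)) fun j hj => ?_).trans ?_
      · refine (hψd i hi j (hj.trans hk)).trans ?_
        rw [zero_sub, div_eq_mul_one_div, mul_pow, hpow, ← mul_assoc]
        gcongr
        · norm_num
        · exact hj.trans hk
      · rw [zero_sub]
        gcongr
        norm_num

end Partition

section Extension

variable {X Y : Type*} [NormedAddCommGroup X] [NormedSpace ℝ X]
  [NormedAddCommGroup Y] [NormedSpace ℝ Y] {V : Set X} {T : X → X → Y} {n : ℕ} {β C : ℝ}

/-- Compatibility of a field of polynomials implies compatibility of its derivatives. -/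
theorem exists_norm_iteratedFDeriv_sub_le (hC : 0 ≤ C) (hβ : 0 ≤ β)
    (hT : ∀ u ∈ V, IsPolyMap (n + 1) (T u))
    (hcompat : ∀ u ∈ V, ∀ v ∈ V, ∀ x, ‖T u x - T v x‖ ≤ C * (‖x - v‖ + ‖v - u‖) ^ β) :
    ∃ K : ℝ, 0 ≤ K ∧ ∀ u ∈ V, ∀ v ∈ V, ∀ r : ℝ, 0 < r → ‖v - u‖ ≤ r → ∀ k ≤ n + 1, ∀ x,
      ‖iteratedFDeriv ℝ k (T u - T v) x‖ ≤ K * (‖x - v‖ + r) ^ (β - k) := by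
  obtain ⟨W, hW, h⟩ := exists_norm_iteratedFDeriv_le X Y (n + 1) β
  refine ⟨C * W, by positivity, fun u hu v hv r hr hvu k hk x => ?_⟩
  refine h ((hT u hu).sub (hT v hv)) hC hr (fun x => (hcompat u hu v hv x).trans ?_) k hk x
  gcongr

theorem norm_iteratedFDeriv_sub_le {K : ℝ} (hK : 0 ≤ K)
    (hT : ∀ u ∈ V, IsPolyMap (n + 1) (T u))
    (hM : ∀ u ∈ V, ∀ v ∈ V, ∀ r : ℝ, 0 < r → ‖v - u‖ ≤ r → ∀ k ≤ n + 1, ∀ x,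
      ‖iteratedFDeriv ℝ k (T u - T v) x‖ ≤ K * (‖x - v‖ + r) ^ (β - k))
    {u v : X} (hu : u ∈ V) (hv : v ∈ V) {k : ℕ} (hk : k ≤ n + 1) (x : X) :
    ‖iteratedFDeriv ℝ k (T u) x - iteratedFDeriv ℝ k (T v) x‖
      ≤ K * (‖x - v‖ + ‖v - u‖) ^ (β - k) := by
  rcases eq_or_ne v u with rfl | hne
  · rw [sub_self, norm_zero]
    positivity
  · rw [← iteratedFDeriv_sub_apply (hT u hu).contDiff.contDiffAt (hT v hv).contDiff.contDiffAt]
    exact hM u hu v hv _ (norm_pos_iff.2 (sub_ne_zero.2 hne)) le_rfl k hk x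

/-- Away from the closed set `V`, the jets are glued by a Whitney partition of unity. -/
theorem exists_extension_compl [FiniteDimensional ℝ X] (hV : IsClosed V) (hne : V.Nonempty)
    {K : ℝ} (hK : 0 ≤ K) (hT : ∀ u ∈ V, IsPolyMap (n + 1) (T u))
    (hM : ∀ u ∈ V, ∀ v ∈ V, ∀ r : ℝ, 0 < r → ‖v - u‖ ≤ r → ∀ k ≤ n + 1, ∀ x,
      ‖iteratedFDeriv ℝ k (T u - T v) x‖ ≤ K * (‖x - v‖ + r) ^ (β - k)) :
    ∃ (F : X → Y) (K₁ : ℝ), 0 ≤ K₁ ∧ ∀ x, 0 < infDist x V → ContDiffAt ℝ ∞ F x ∧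
      ∀ p ∈ V, infDist x V = ‖x - p‖ → ∀ k ≤ n + 1,
        ‖iteratedFDeriv ℝ k F x - iteratedFDeriv ℝ k (T p) x‖ ≤ K₁ * infDist x V ^ (β - k) := by
  have : ProperSpace X := FiniteDimensional.proper ℝ X
  obtain ⟨S, φ, N, M, hM0, hφ, hpart⟩ := exists_whitney_partition V (n + 1)
  have hq' : ∀ x : X, ∃ y ∈ V, infDist x V = ‖x - y‖ := fun x => by
    simpa only [dist_eq_norm] using hV.exists_infDist_eq_dist hne x
  choose q hqV hqd using hq'
  have local_eq : ∀ x, 0 < infDist x V → ∀ p ∈ V, ∀ A : Finset S,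
      (∀ᶠ y in 𝓝 x, ∀ i ∉ A, φ i y = 0) → (∀ᶠ y in 𝓝 x, ∑ i ∈ A, φ i y = 1) →
      (fun y => ∑ᶠ i, φ i y • T (q i) y) =ᶠ[𝓝 x]
        (T p + fun y => ∑ i ∈ A, φ i y • (T (q i) - T p) y) := by
    intro x hx p hp A h0 h1
    filter_upwards [h0, h1] with y h0 h1
    rw [finsum_eq_sum_of_support_subset (s := A)]
    · simp only [Pi.add_apply, Pi.sub_apply, smul_sub, Finset.sum_sub_distrib, ← Finset.sum_smul,
        h1, one_smul, add_sub_cancel]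
    · intro i hi
      by_contra hiA
      exact hi (by simp only [h0 i hiA, zero_smul])
  have hsm : ∀ p ∈ V, ∀ i : S, ContDiff ℝ ∞ (fun y => φ i y • (T (q i) - T p) y) :=
    fun p hp i => (hφ i).smul ((hT _ (hqV i)).sub (hT p hp)).contDiff
  refine ⟨fun y => ∑ᶠ i, φ i y • T (q i) y, N * (2 ^ (n + 1) * M * (K * 7 ^ β)), by positivity,
    fun x hx => ⟨?_, ?_⟩⟩
  · obtain ⟨A, -, -, h0, h1, -⟩ := hpart x hx
    have hp := hqV x
    refine ContDiffAt.congr_of_eventuallyEq ?_ (local_eq x hx _ hp A h0 h1)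
    exact ((hT _ hp).contDiff.add (ContDiff.sum fun i _ => hsm _ hp i)).contDiffAt
  · intro p hp hxp k hk
    obtain ⟨A, hAN, hA, h0, h1, hA'⟩ := hpart x hx
    set d := infDist x V with hd
    have hkn : ((k : ℕ) : ℕ∞ω) ≤ (∞ : ℕ∞ω) := mod_cast le_top
    rw [((local_eq x hx p hp A h0 h1).iteratedFDeriv ℝ k).eq_of_nhds,
      iteratedFDeriv_add_apply (hT p hp).contDiff.contDiffAt
        ((ContDiff.sum fun i _ => hsm _ hp i).of_le hkn).contDiffAt, add_sub_cancel_left,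
      iteratedFDeriv_sum (fun i _ => (hsm _ hp i).of_le hkn), Finset.sum_apply]
    have hterm : ∀ i ∈ A, ‖iteratedFDeriv ℝ k (fun y => φ i y • (T (q i) - T p) y) x‖
        ≤ 2 ^ (n + 1) * M * (K * 7 ^ β) * d ^ (β - k) := by
      intro i hi
      refine (norm_iteratedFDeriv_smul_le_of_scaled (hφ i)
        ((hT _ (hqV i)).sub (hT p hp)).contDiff hx hM0 (M₂ := K * 7 ^ β) (β := β)
        (fun j hj => hA' i hi j (hj.trans hk)) fun j hj => ?_).trans ?_
      · have h6 : ‖p - q i‖ ≤ 6 * d := by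
          have e : p - q i = (p - x) + (x - i) + ((i : X) - q i) := by abel
          rw [e]
          refine (norm_add₃_le).trans ?_
          rw [norm_sub_rev p x, ← hxp, ← hqd i]
          linarith [(hA i hi).1, (hA i hi).2]
        refine (hM _ (hqV i) p hp (6 * d) (by positivity) h6 j (hj.trans hk) x).trans ?_
        rw [← hxp, mul_assoc, show d + 6 * d = 7 * d by ring, Real.mul_rpow (by norm_num) hx.le]
        gcongr
        · norm_num
        · simp
      · gcongr
        · norm_num
    calc _ ≤ ∑ i ∈ A, 2 ^ (n + 1) * M * (K * 7 ^ β) * d ^ (β - k) := norm_sum_le_of_le _ hterm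
      _ = A.card * (2 ^ (n + 1) * M * (K * 7 ^ β) * d ^ (β - k)) := by
        rw [Finset.sum_const, nsmul_eq_mul]
      _ ≤ N * (2 ^ (n + 1) * M * (K * 7 ^ β) * d ^ (β - k)) := by gcongr
      _ = _ := by ring

theorem hasFDerivAt_of_norm_sub_le {g h : X → Y} {h' : X →L[ℝ] Y} {u : X} {K γ : ℝ} (hγ : 1 < γ)
    (hgh : ∀ y, ‖g y - h y‖ ≤ K * ‖y - u‖ ^ γ) (hh : HasFDerivAt h h' u) :
    HasFDerivAt g h' u := by
  have hu : g u = h u := by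
    have := hgh u
    rwa [sub_self, norm_zero, Real.zero_rpow (by linarith), mul_zero, norm_le_zero_iff,
      sub_eq_zero] at this
  have hlim : Tendsto (fun y => ‖y - u‖ ^ (γ - 1)) (𝓝 u) (𝓝 0) := by
    have : ContinuousAt (fun y => ‖y - u‖ ^ (γ - 1)) u :=
      ContinuousAt.rpow_const (by fun_prop) (Or.inr (by linarith))
    simpa [ContinuousAt, Real.zero_rpow (by linarith : γ - 1 ≠ 0)] using this
  have ho : (fun y => g y - h y) =o[𝓝 u] fun y => y - u := by
    refine (Asymptotics.IsBigO.of_bound K (Eventually.of_forall fun y => ?_)).trans_isLittleO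
      (g := fun y => ‖y - u‖ ^ (γ - 1) * ‖y - u‖) ?_
    · refine (hgh y).trans_eq ?_
      rw [Real.norm_of_nonneg (by positivity)]
      rcases (norm_nonneg (y - u)).eq_or_lt with h0 | h0
      · rw [← h0, Real.zero_rpow (by linarith), mul_zero, mul_zero, mul_zero]
      · rw [Real.rpow_sub_one h0.ne', div_mul_cancel₀ _ h0.ne']
    · have := ((Asymptotics.isLittleO_one_iff ℝ).2 hlim).mul_isBigO
        (Asymptotics.isBigO_refl (fun y => ‖y - u‖) (𝓝 u))
      simpa using this.norm_right
  have h2 : HasFDerivAt (fun y => g y - h y) (0 : X →L[ℝ] Y) u :=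
    .of_isLittleO (by simpa [hu] using ho)
  simpa only [Pi.add_def, sub_add_cancel, zero_add] using h2.add hh

theorem continuousAt_of_norm_sub_le {X Y : Type*} [NormedAddCommGroup X] [NormedAddCommGroup Y]
    {g h : X → Y} {u : X} {K γ : ℝ} (hγ : 0 < γ)
    (hgh : ∀ y, ‖g y - h y‖ ≤ K * ‖y - u‖ ^ γ) (hh : ContinuousAt h u) : ContinuousAt g u := by
  have hu : g u = h u := by
    have := hgh u
    rwa [sub_self, norm_zero, Real.zero_rpow hγ.ne', mul_zero, norm_le_zero_iff,
      sub_eq_zero] at this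
  have hlim : Tendsto (fun y => K * ‖y - u‖ ^ γ) (𝓝 u) (𝓝 0) := by
    have : ContinuousAt (fun y => K * ‖y - u‖ ^ γ) u :=
      continuousAt_const.mul (ContinuousAt.rpow_const (by fun_prop) (Or.inr hγ.le))
    simpa [ContinuousAt, Real.zero_rpow hγ.ne'] using this
  have h2 : Tendsto (fun y => g y - h y) (𝓝 u) (𝓝 0) := squeeze_zero_norm hgh hlim
  simpa [ContinuousAt, hu] using h2.add hh

open Classical in
/-- The candidate Taylor series of the extension: the prescribed jets on `V`, and the Taylor
series of `F` elsewhere. -/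
noncomputable def gluedSeries (V : Set X) (T : X → X → Y) (F : X → Y) :
    X → FormalMultilinearSeries ℝ X Y :=
  fun x k => if x ∈ V then iteratedFDeriv ℝ k (T x) x else iteratedFDeriv ℝ k F x

theorem norm_gluedSeries_sub_le [FiniteDimensional ℝ X] (hV : IsClosed V)
    {F : X → Y} {K K₁ : ℝ} (hK : 0 ≤ K) (hK₁ : 0 ≤ K₁) (hβ : n ≤ β)
    (hT : ∀ u ∈ V, IsPolyMap (n + 1) (T u))
    (hM : ∀ u ∈ V, ∀ v ∈ V, ∀ r : ℝ, 0 < r → ‖v - u‖ ≤ r → ∀ k ≤ n + 1, ∀ x,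
      ‖iteratedFDeriv ℝ k (T u - T v) x‖ ≤ K * (‖x - v‖ + r) ^ (β - k))
    (hF : ∀ x, 0 < infDist x V → ∀ p ∈ V, infDist x V = ‖x - p‖ → ∀ k ≤ n + 1,
      ‖iteratedFDeriv ℝ k F x - iteratedFDeriv ℝ k (T p) x‖ ≤ K₁ * infDist x V ^ (β - k))
    (x : X) {u : X} (hu : u ∈ V) {k : ℕ} (hk : k ≤ n) :
    ‖gluedSeries V T F x k - iteratedFDeriv ℝ k (T u) x‖ ≤
      (K₁ + K * 3 ^ β) * ‖x - u‖ ^ (β - k) := by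
  have : ProperSpace X := FiniteDimensional.proper ℝ X
  have hkβ : 0 ≤ β - k := sub_nonneg.2 (le_trans (mod_cast hk) hβ)
  have h3 : K * 3 ^ (β - k) ≤ K * 3 ^ β := by
    gcongr
    · norm_num
    · simp
  unfold gluedSeries
  split_ifs with hx
  · refine (norm_iteratedFDeriv_sub_le hK hT hM hx hu (hk.trans n.le_succ) x).trans ?_
    rw [norm_sub_rev u x]
    have h2 : ‖x - u‖ + ‖x - u‖ ≤ 3 * ‖x - u‖ := by linarith [norm_nonneg (x - u)]
    calc K * (‖x - u‖ + ‖x - u‖) ^ (β - k) ≤ K * (3 * ‖x - u‖) ^ (β - k) := by gcongr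
      _ = K * 3 ^ (β - k) * ‖x - u‖ ^ (β - k) := by
        rw [Real.mul_rpow (by norm_num) (norm_nonneg _), mul_assoc]
      _ ≤ _ := by
        gcongr
        linarith
  · have hd := (hV.notMem_iff_infDist_pos ⟨u, hu⟩).1 hx
    obtain ⟨p, hp, hxp⟩ := hV.exists_infDist_eq_dist ⟨u, hu⟩ x
    rw [dist_eq_norm] at hxp
    have hdu : infDist x V ≤ ‖x - u‖ := by
      simpa only [dist_eq_norm] using infDist_le_dist_of_mem (x := x) hu
    have hup : ‖u - p‖ ≤ 2 * ‖x - u‖ := by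
      calc ‖u - p‖ = ‖(u - x) + (x - p)‖ := by rw [sub_add_sub_cancel]
        _ ≤ ‖u - x‖ + ‖x - p‖ := norm_add_le _ _
        _ ≤ _ := by rw [norm_sub_rev u x, ← hxp]; linarith
    have h1 := hF x hd p hp hxp k (hk.trans n.le_succ)
    have h2 := norm_iteratedFDeriv_sub_le hK hT hM hp hu (hk.trans n.le_succ) x
    calc _ ≤ _ := norm_sub_le_norm_sub_add_norm_sub _ (iteratedFDeriv ℝ k (T p) x) _
      _ ≤ K₁ * infDist x V ^ (β - k) + K * (‖x - u‖ + ‖u - p‖) ^ (β - k) := add_le_add h1 h2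
      _ ≤ K₁ * ‖x - u‖ ^ (β - k) + K * (3 * ‖x - u‖) ^ (β - k) := by
        gcongr
        linarith
      _ = (K₁ + K * 3 ^ (β - k)) * ‖x - u‖ ^ (β - k) := by
        rw [Real.mul_rpow (by norm_num) (norm_nonneg _)]
        ring
      _ ≤ _ := by gcongr

theorem hasFTaylorSeriesUpTo_gluedSeries (hV : IsClosed V) {F : X → Y} {K : ℝ} (hβ : n < β)
    (hT : ∀ u ∈ V, IsPolyMap (n + 1) (T u)) (hF : ∀ x ∉ V, ContDiffAt ℝ ∞ F x)
    (hG : ∀ x, ∀ u ∈ V, ∀ k ≤ n,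
      ‖gluedSeries V T F x k - iteratedFDeriv ℝ k (T u) x‖ ≤ K * ‖x - u‖ ^ (β - k)) :
    HasFTaylorSeriesUpTo n (fun x => (gluedSeries V T F x 0).curry0) (gluedSeries V T F) := by
  have hmem : ∀ u ∈ V, ∀ k, gluedSeries V T F u k = iteratedFDeriv ℝ k (T u) u :=
    fun u hu k => if_pos hu
  have hnot : ∀ x ∉ V, ∀ k, (fun y => gluedSeries V T F y k) =ᶠ[𝓝 x] iteratedFDeriv ℝ k F := by
    intro x hx k
    filter_upwards [hV.isOpen_compl.mem_nhds hx] with y hy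
    exact if_neg hy
  refine ⟨fun x => rfl, fun m hm x => ?_, fun m hm => continuous_iff_continuousAt.2 fun x => ?_⟩
  · have hmn : m < n := mod_cast hm
    by_cases hx : x ∈ V
    · have hγ : 1 < β - m := by
        have : (m : ℝ) + 1 ≤ n := mod_cast hmn
        linarith
      refine hasFDerivAt_of_norm_sub_le hγ (fun y => hG y x hx m hmn.le) ?_
      rw [hmem x hx]
      exact ((hT x hx).contDiff.differentiable_iteratedFDeriv
        (m := m) (n := ∞) (mod_cast ENat.natCast_lt_top m) x).hasFDerivAt
    · have h1 : gluedSeries V T F x m.succ = iteratedFDeriv ℝ (m + 1) F x :=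
        (hnot x hx _).eq_of_nhds
      rw [h1]
      exact ((hF x hx).differentiableAt_iteratedFDeriv
        (m := m) (mod_cast ENat.natCast_lt_top m)).hasFDerivAt.congr_of_eventuallyEq (hnot x hx m)
  · have hmn : m ≤ n := mod_cast hm
    by_cases hx : x ∈ V
    · have hγ : 0 < β - m := by
        have : (m : ℝ) ≤ n := mod_cast hmn
        linarith
      refine continuousAt_of_norm_sub_le hγ (fun y => hG y x hx m hmn) ?_
      exact (hT x hx).contDiff.contDiffAt.continuousAt_iteratedFDeriv (n := m) le_rfl
    · exact ((hF x hx).continuousAt_iteratedFDeriv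
        (mod_cast le_top)).congr (hnot x hx m).symm

/-- **Whitney's extension theorem** for a closed set. -/
theorem exists_extension_of_isClosed [FiniteDimensional ℝ X] (hV : IsClosed V)
    (hne : V.Nonempty) {α : ℝ} (hα : α ∈ Ioc (0 : ℝ) 1) (hC : 0 ≤ C)
    (hT : ∀ u ∈ V, IsPolyMap (n + 1) (T u))
    (hcompat : ∀ u ∈ V, ∀ v ∈ V, ∀ x,
      ‖T u x - T v x‖ ≤ C * (‖x - v‖ + ‖v - u‖) ^ ((n : ℝ) + α)) :
    ∃ F : X → Y, ContDiff ℝ n F ∧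
      (∃ K : ℝ, ∀ x y : X,
        ‖iteratedFDeriv ℝ n F x - iteratedFDeriv ℝ n F y‖ ≤ K * ‖x - y‖ ^ α) ∧
      ∀ u ∈ V, ∀ m ≤ n, iteratedFDeriv ℝ m F u = iteratedFDeriv ℝ m (T u) u := by
  have : ProperSpace X := FiniteDimensional.proper ℝ X
  have hβ : (n : ℝ) < n + α := by linarith [hα.1]
  obtain ⟨K, hK, hM⟩ := exists_norm_iteratedFDeriv_sub_le hC (by positivity [hα.1]) hT hcompat
  obtain ⟨F₀, K₁, hK₁, hF₀⟩ := exists_extension_compl hV hne hK hT hM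
  have hd : ∀ x ∉ V, 0 < infDist x V := fun x hx => (hV.notMem_iff_infDist_pos hne).1 hx
  set K₂ := K₁ + K * 3 ^ ((n : ℝ) + α) with hK₂
  have hK₂0 : 0 ≤ K₂ := by positivity
  have hG := norm_gluedSeries_sub_le hV hK hK₁ hβ.le hT hM fun x hx => (hF₀ x hx).2
  have hS := hasFTaylorSeriesUpTo_gluedSeries hV hβ hT (fun x hx => (hF₀ x (hd x hx)).1)
    (fun x u hu k hk => hG x hu hk)
  set F : X → Y := fun x => (gluedSeries V T F₀ x 0).curry0 with hF
  have hS' : ∀ x, ∀ m ≤ n, gluedSeries V T F₀ x m = iteratedFDeriv ℝ m F x :=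
    fun x m hm => hS.eq_iteratedFDeriv (mod_cast hm) x
  have hFF₀ : ∀ x ∉ V, F =ᶠ[𝓝 x] F₀ := by
    intro x hx
    filter_upwards [hV.isOpen_compl.mem_nhds hx] with y hy
    have : gluedSeries V T F₀ y 0 = iteratedFDeriv ℝ 0 F₀ y := if_neg hy
    rw [hF]
    simp [this]
  refine ⟨F, hS.contDiff (n := n), ⟨K₁ + 2 * K₂ * 3 ^ α, fun x y => ?_⟩, fun u hu m hm => ?_⟩
  swap
  · rw [← hS' u m hm]
    exact if_pos hu
  rcases eq_or_ne x y with rfl | hxy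
  · rw [sub_self, norm_zero]
    positivity
  have hxy0 : 0 < ‖x - y‖ := norm_pos_iff.2 (sub_ne_zero.2 hxy)
  rcases le_or_gt (2 * ‖x - y‖) (infDist x V) with hfar | hnear
  · have hdist : ∀ z ∈ closedBall x ‖x - y‖, ‖x - y‖ ≤ infDist z V := by
      intro z hz
      rw [mem_closedBall, dist_eq_norm, norm_sub_rev] at hz
      linarith [infDist_le_infDist_add_norm V x z]
    have hzV : ∀ z ∈ closedBall x ‖x - y‖, z ∉ V := fun z hz =>
      (hV.notMem_iff_infDist_pos hne).2 (hxy0.trans_le (hdist z hz))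
    have hmv := Convex.norm_image_sub_le_of_norm_fderiv_le (𝕜 := ℝ)
      (f := iteratedFDeriv ℝ n F) (C := K₁ * ‖x - y‖ ^ (α - 1)) (s := closedBall x ‖x - y‖)
      (x := y) (y := x) ?_ ?_ (convex_closedBall _ _)
      (by rw [mem_closedBall, dist_eq_norm, norm_sub_rev]) (mem_closedBall_self hxy0.le)
    · refine hmv.trans ?_
      rw [mul_assoc, Real.rpow_sub_one hxy0.ne', div_mul_cancel₀ _ hxy0.ne']
      gcongr
      have : 0 ≤ 2 * K₂ * 3 ^ α := by positivity
      linarith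
    · intro z hz
      have := ((hF₀ z (hd z (hzV z hz))).1.congr_of_eventuallyEq (hFF₀ z (hzV z hz)))
      exact this.differentiableAt_iteratedFDeriv (mod_cast ENat.natCast_lt_top n)
    · intro z hz
      obtain ⟨p, hp, hzp⟩ := hV.exists_infDist_eq_dist hne z
      rw [dist_eq_norm] at hzp
      have h1 := (hF₀ z (hd z (hzV z hz))).2 p hp hzp (n + 1) le_rfl
      rw [(hT p hp).iteratedFDeriv_eq_zero, sub_zero,
        ← ((hFF₀ z (hzV z hz)).iteratedFDeriv ℝ (n + 1)).eq_of_nhds] at h1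
      rw [norm_fderiv_iteratedFDeriv]
      refine h1.trans ?_
      rw [show (n : ℝ) + α - (n + 1 : ℕ) = α - 1 by push_cast; ring]
      exact mul_le_mul_of_nonneg_left
        (Real.rpow_le_rpow_of_nonpos hxy0 (hdist z hz) (by linarith [hα.2])) hK₁
  · obtain ⟨u, hu, hxu⟩ := hV.exists_infDist_eq_dist hne x
    rw [dist_eq_norm] at hxu
    have hyu : ‖y - u‖ ≤ 3 * ‖x - y‖ := by
      calc ‖y - u‖ = ‖(y - x) + (x - u)‖ := by rw [sub_add_sub_cancel]
        _ ≤ ‖y - x‖ + ‖x - u‖ := norm_add_le _ _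
        _ ≤ _ := by rw [norm_sub_rev y x]; linarith
    have h1 := hG x hu le_rfl
    have h2 := hG y hu le_rfl
    rw [hS' _ _ le_rfl, add_sub_cancel_left] at h1 h2
    rw [(hT u hu).iteratedFDeriv_eq_const y x, norm_sub_rev] at h2
    have hα0 := hα.1.le
    calc _ ≤ _ := norm_sub_le_norm_sub_add_norm_sub _ (iteratedFDeriv ℝ n (T u) x) _
      _ ≤ K₂ * ‖x - u‖ ^ α + K₂ * ‖y - u‖ ^ α := add_le_add h1 h2
      _ ≤ K₂ * (3 * ‖x - y‖) ^ α + K₂ * (3 * ‖x - y‖) ^ α := by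
        gcongr
        linarith
      _ = 2 * K₂ * 3 ^ α * ‖x - y‖ ^ α := by
        rw [Real.mul_rpow (by norm_num) hxy0.le]
        ring
      _ ≤ _ := by
        gcongr
        linarith

end Extension

section Closure

variable {X Y : Type*} [NormedAddCommGroup X] [NormedSpace ℝ X]
  [NormedAddCommGroup Y] [NormedSpace ℝ Y]

theorem isPolyMap_sum (N : ℕ) (p : FormalMultilinearSeries ℝ X Y) (u : X) :
    IsPolyMap N fun x => ∑ m ∈ Finset.range N, (m.factorial : ℝ)⁻¹ • p m (fun _ => x - u) := by
  refine .of_hasFiniteFPowerSeriesOnBall (x := u)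
    (p := fun m => if m < N then (m.factorial : ℝ)⁻¹ • p m else 0) (.mk' (fun m hm => ?_) ?_ ?_)
  · exact if_neg hm.not_gt
  · simp
  · intro y _
    refine Finset.sum_congr rfl fun m hm => ?_
    rw [if_pos (Finset.mem_range.1 hm), add_sub_cancel_left]
    rfl

variable {V : Set X} {T : X → X → Y} {n : ℕ} {β C : ℝ} [CompleteSpace Y]

/-- A compatible field of polynomials extends to the closure of its domain. -/
theorem exists_tendsto_of_mem_closure (hC : 0 ≤ C) (hβ : n < β)
    (hT : ∀ u ∈ V, IsPolyMap (n + 1) (T u))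
    (hcompat : ∀ u ∈ V, ∀ v ∈ V, ∀ x, ‖T u x - T v x‖ ≤ C * (‖x - v‖ + ‖v - u‖) ^ β)
    {u : X} (hu : u ∈ closure V) :
    ∃ Q : X → Y, IsPolyMap (n + 1) Q ∧ ∀ x, Tendsto (fun v => T v x) (𝓝[V] u) (𝓝 (Q x)) := by
  have hne : (𝓝[V] u).NeBot := mem_closure_iff_nhdsWithin_neBot.1 hu
  obtain ⟨K, hK, hM⟩ :=
    exists_norm_iteratedFDeriv_sub_le hC (n.cast_nonneg.trans hβ.le) hT hcompat
  have hlim : ∀ k, ∃ A, k ≤ n → Tendsto (fun v => iteratedFDeriv ℝ k (T v) u) (𝓝[V] u) (𝓝 A) := by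
    intro k
    by_cases hk : k ≤ n
    swap
    · exact ⟨0, fun h => absurd h hk⟩
    have hkβ : 0 < β - k := sub_pos.2 (lt_of_le_of_lt (mod_cast hk) hβ)
    suffices Cauchy (map (fun v => iteratedFDeriv ℝ k (T v) u) (𝓝[V] u)) from
      (cauchy_map_iff_exists_tendsto.1 this).imp fun A hA _ => hA
    rw [cauchy_map_iff', tendsto_uniformity_iff_dist_tendsto_zero]
    refine squeeze_zero' (g := fun z : X × X => K * (‖u - z.2‖ + ‖z.2 - z.1‖) ^ (β - k))
      (Eventually.of_forall fun _ => dist_nonneg) ?_ ?_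
    · filter_upwards [eventually_mem_nhdsWithin.prod_mk eventually_mem_nhdsWithin] with z hz
      rw [dist_eq_norm]
      exact norm_iteratedFDeriv_sub_le hK hT hM hz.1 hz.2 (hk.trans n.le_succ) u
    · have hc : ContinuousAt (fun z : X × X => K * (‖u - z.2‖ + ‖z.2 - z.1‖) ^ (β - k)) (u, u) :=
        continuousAt_const.mul (ContinuousAt.rpow_const (by fun_prop) (Or.inr hkβ.le))
      have h0 : Tendsto (fun z : X × X => K * (‖u - z.2‖ + ‖z.2 - z.1‖) ^ (β - k)) (𝓝 (u, u))
          (𝓝 0) := by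
        simpa [ContinuousAt, Real.zero_rpow hkβ.ne'] using hc
      rw [nhds_prod_eq] at h0
      exact h0.mono_left (prod_mono nhdsWithin_le_nhds nhdsWithin_le_nhds)
  choose A hA using hlim
  refine ⟨_, isPolyMap_sum (n + 1) A u, fun x => ?_⟩
  have hev : ∀ᶠ v in 𝓝[V] u, ∑ m ∈ Finset.range (n + 1),
      (m.factorial : ℝ)⁻¹ • iteratedFDeriv ℝ m (T v) u (fun _ => x - u) = T v x := by
    filter_upwards [eventually_mem_nhdsWithin] with v hv
    rw [(hT v hv).taylor, add_sub_cancel]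
  refine Tendsto.congr' hev (tendsto_finsetSum _ fun m hm => Tendsto.const_smul ?_ _)
  exact ((continuous_eval_const _).tendsto _).comp
    (hA m (Nat.lt_succ_iff.1 (Finset.mem_range.1 hm)))

/-- **Whitney's extension theorem** for an arbitrary nonempty set. -/
theorem exists_extension [FiniteDimensional ℝ X]
    (hne : V.Nonempty) {α : ℝ} (hα : α ∈ Ioc (0 : ℝ) 1) (hC : 0 ≤ C)
    (hT : ∀ u ∈ V, IsPolyMap (n + 1) (T u))
    (hcompat : ∀ u ∈ V, ∀ v ∈ V, ∀ x,
      ‖T u x - T v x‖ ≤ C * (‖x - v‖ + ‖v - u‖) ^ ((n : ℝ) + α)) :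
    ∃ F : X → Y, ContDiff ℝ n F ∧
      (∃ K : ℝ, ∀ x y : X,
        ‖iteratedFDeriv ℝ n F x - iteratedFDeriv ℝ n F y‖ ≤ K * ‖x - y‖ ^ α) ∧
      ∀ u ∈ V, ∀ m ≤ n, iteratedFDeriv ℝ m F u = iteratedFDeriv ℝ m (T u) u := by
  have hα0 := hα.1
  have hβ : (n : ℝ) < n + α := by linarith
  have hQ : ∀ u, ∃ Q : X → Y, u ∈ closure V →
      IsPolyMap (n + 1) Q ∧ ∀ x, Tendsto (fun v => T v x) (𝓝[V] u) (𝓝 (Q x)) := by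
    intro u
    by_cases hu : u ∈ closure V
    · exact (exists_tendsto_of_mem_closure hC hβ hT hcompat hu).imp fun Q hQ _ => hQ
    · exact ⟨0, fun h => absurd h hu⟩
  choose Q hQ using hQ
  have hQT : ∀ u ∈ V, Q u = T u := by
    intro u hu
    ext x
    exact tendsto_nhds_unique (((hQ u (subset_closure hu)).2 x).mono_left (pure_le_nhdsWithin hu))
      (tendsto_pure_nhds _ u)
  have hcompat' : ∀ u ∈ closure V, ∀ v ∈ closure V, ∀ x,
      ‖Q u x - Q v x‖ ≤ C * (‖x - v‖ + ‖v - u‖) ^ ((n : ℝ) + α) := by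
    intro u hu v hv x
    have hu' : (𝓝[V] u).NeBot := mem_closure_iff_nhdsWithin_neBot.1 hu
    have hv' : (𝓝[V] v).NeBot := mem_closure_iff_nhdsWithin_neBot.1 hv
    have h1 : Tendsto (fun z : X × X => ‖T z.1 x - T z.2 x‖) (𝓝[V] u ×ˢ 𝓝[V] v)
        (𝓝 ‖Q u x - Q v x‖) :=
      ((((hQ u hu).2 x).comp tendsto_fst).sub (((hQ v hv).2 x).comp tendsto_snd)).norm
    have hc : Continuous fun z : X × X => C * (‖x - z.2‖ + ‖z.2 - z.1‖) ^ ((n : ℝ) + α) :=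
      continuous_const.mul (Continuous.rpow_const (by fun_prop) fun _ => Or.inr (by positivity))
    have h2 := hc.tendsto (u, v)
    rw [nhds_prod_eq] at h2
    refine le_of_tendsto_of_tendsto h1
      (h2.mono_left (prod_mono nhdsWithin_le_nhds nhdsWithin_le_nhds)) ?_
    filter_upwards [eventually_mem_nhdsWithin.prod_mk eventually_mem_nhdsWithin] with z hz
    exact hcompat _ hz.1 _ hz.2 x
  obtain ⟨F, hF, hFα, hFQ⟩ := exists_extension_of_isClosed isClosed_closure hne.closure
    hα hC (fun u hu => (hQ u hu).1) hcompat'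
  refine ⟨F, hF, hFα, fun u hu m hm => ?_⟩
  rw [hFQ u (subset_closure hu) m hm, hQT u hu]

end Closure

end WhitneyExtension

/-- **Whitney extension theorem (Theorem 2.5).** Let `X` be finite-dimensional, `Y` a Banach
space, `V ⊆ X` arbitrary, and suppose that for each `u ∈ V` a polynomial
`P(·,u) = ∑_{m=0}^n (1/m!) Pk m u [{ξ}^m] ∈ 𝒫ⁿ(X,Y)` is given satisfying the compatibility
conditions `‖P(ξ+δ,u) − P(ξ,u+δ)‖ ≤ C(‖ξ‖+‖δ‖)^{n+α}` for `u, u+δ ∈ V`, `ξ ∈ X`. Then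
there exists `F ∈ C^{n,α}(X,Y)` with `Jⁿ_ξ F(u) = P(ξ,u)` for all `u ∈ V`, `ξ ∈ X`. -/
theorem stmt_6 {X Y : Type*} [NormedAddCommGroup X] [NormedSpace ℝ X]
    [FiniteDimensional ℝ X]
    [NormedAddCommGroup Y] [NormedSpace ℝ Y] [CompleteSpace Y]
    (V : Set X) (n : ℕ) (α C : ℝ) (hα : α ∈ Set.Ioc (0 : ℝ) 1) (hC : 0 < C)
    (Pk : (m : ℕ) → X → ContinuousMultilinearMap ℝ (fun _ : Fin m => X) Y)
    (hsymm : ∀ (m : ℕ) (u : X) (v : Fin m → X) (σ : Equiv.Perm (Fin m)),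
        Pk m u (v ∘ σ) = Pk m u v)
    (hcompat : ∀ u ∈ V, ∀ δ : X, u + δ ∈ V → ∀ ξ : X,
        ‖(∑ m ∈ Finset.range (n + 1), (m.factorial : ℝ)⁻¹ • Pk m u (fun _ => ξ + δ)) -
            ∑ m ∈ Finset.range (n + 1), (m.factorial : ℝ)⁻¹ • Pk m (u + δ) (fun _ => ξ)‖ ≤
          C * (‖ξ‖ + ‖δ‖) ^ ((n : ℝ) + α)) :
    ∃ F : X → Y, ContDiff ℝ n F ∧
      (∃ K : ℝ, ∀ x y : X,
          ‖iteratedFDeriv ℝ n F x - iteratedFDeriv ℝ n F y‖ ≤ K * ‖x - y‖ ^ α) ∧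
      ∀ u ∈ V, ∀ ξ : X,
        ∑ m ∈ Finset.range (n + 1),
            (m.factorial : ℝ)⁻¹ • iteratedFDeriv ℝ m F u (fun _ => ξ) =
          ∑ m ∈ Finset.range (n + 1), (m.factorial : ℝ)⁻¹ • Pk m u (fun _ => ξ) := by
  rcases V.eq_empty_or_nonempty with rfl | hne
  · refine ⟨0, contDiff_const, ⟨0, fun x y => ?_⟩, by simp⟩
    simp [show (0 : X → Y) = fun _ => 0 from rfl]
  set T : X → X → Y := fun u x =>
    ∑ m ∈ Finset.range (n + 1), (m.factorial : ℝ)⁻¹ • Pk m u (fun _ => x - u) with hT_def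
  have hT : ∀ u, WhitneyExtension.IsPolyMap (n + 1) (T u) := fun u =>
    WhitneyExtension.isPolyMap_sum (n + 1) (fun m => Pk m u) u
  obtain ⟨F, hF, hFα, hFT⟩ := WhitneyExtension.exists_extension (T := T) hne hα hC.le
    (fun u _ => hT u) fun u hu v hv x => by
      have h := hcompat u hu (v - u) (by rwa [add_sub_cancel]) (x - v)
      rwa [sub_add_sub_cancel, add_sub_cancel] at h
  refine ⟨F, hF, hFα, fun u hu ξ => ?_⟩
  have h := (hT u).taylor u ξ
  simp only [hT_def, add_sub_cancel_left] at h
  rw [← h]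
  refine Finset.sum_congr rfl fun m hm => ?_
  rw [hFT u hu m (Nat.lt_succ_iff.1 (Finset.mem_range.1 hm))]
end

section
/- Let λ, θ ∈ ℝ with λ > θ, and let h : ℝ → ℝ be measurable with ∫_ℝ e^{2θt} h(t)² dt < ∞. Then v(t) := ∫_{−∞}^t e^{−λ(t−s)} h(s) ds is well-defined for all t, locally absolutely continuous, satisfies v'(t) + λ v(t) = h(t) for a.e. t ∈ ℝ, and ∫_ℝ e^{2θt} v(t)² dt ≤ (λ−θ)^{−2} ∫_ℝ e^{2θt} h(t)² dt. Moreover v is the unique locally absolutely continuous function satisfying v' + λv = h a.e. with ∫_ℝ e^{2θt} v(t)² dt < ∞. -/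
open MeasureTheory Real

/-- Integration by parts against an exponential, for a locally absolutely continuous function. -/
lemma exp_mul_eq_add_integral {u f : ℝ → ℝ} (c : ℝ) (hf : ∀ a b, IntervalIntegrable f volume a b)
    (hu : ∀ a t, u t = u a + ∫ s in a..t, f s) (a t : ℝ) :
    exp (c * t) * u t = exp (c * a) * u a + ∫ s in a..t, exp (c * s) * (f s + c * u s) := by
  have hexp : AbsolutelyContinuousOnInterval (fun x => exp (c * x)) a t :=
    ContDiffOn.absolutelyContinuousOnInterval (by fun_prop)
  have hucont : ∀ x, u x = (∫ s in a..x, f s) + u a := fun x => by rw [hu a x, add_comm]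
  have hprim : AbsolutelyContinuousOnInterval (fun x => ∫ s in a..x, f s) a t :=
    (hf a t).absolutelyContinuousOnInterval_intervalIntegral (by simp)
  have huac : AbsolutelyContinuousOnInterval u a t := by
    rw [funext hucont]
    exact hprim.add (ContDiffOn.absolutelyContinuousOnInterval contDiffOn_const)
  rw [← sub_eq_iff_eq_add', ← hexp.integral_deriv_mul_eq_sub huac]
  apply intervalIntegral.integral_congr_ae
  filter_upwards [(hf a t).ae_hasDerivAt_integral] with x hx hxa
  have hdu : HasDerivAt u (f x) x := by
    rw [funext hucont]
    exact (hx (Set.uIoc_subset_uIcc hxa) a (by simp)).add_const _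
  have hde : HasDerivAt (fun x => exp (c * x)) (exp (c * x) * c) x := by
    simpa using ((hasDerivAt_id x).const_mul c).exp
  rw [hdu.deriv, hde.deriv]
  ring

lemma continuous_of_eq_add_integral {u f : ℝ → ℝ} (hf : ∀ a b, IntervalIntegrable f volume a b)
    (hu : ∀ a t, u t = u a + ∫ s in a..t, f s) : Continuous u := by
  rw [funext (hu 0)]
  exact continuous_const.add (intervalIntegral.continuous_primitive hf 0)

lemma integrableOn_exp_neg_mul_sub {μ : ℝ} (hμ : 0 < μ) (t : ℝ) :
    IntegrableOn (fun s => exp (-(μ * (t - s)))) (Set.Iic t) := by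
  refine ((integrableOn_exp_mul_Iic hμ t).const_mul (exp (-(μ * t)))).congr
    (ae_of_all _ fun s => ?_)
  simp only [← exp_add]
  ring_nf

lemma integral_exp_neg_mul_sub {μ : ℝ} (hμ : 0 < μ) (t : ℝ) :
    ∫ s in Set.Iic t, exp (-(μ * (t - s))) = μ⁻¹ := by
  have h (s : ℝ) : exp (-(μ * (t - s))) = exp (-(μ * t)) * exp (μ * s) := by
    rw [← exp_add]; ring_nf
  simp_rw [h]
  rw [integral_const_mul, integral_exp_mul_Iic hμ, ← mul_div_assoc, ← exp_add]
  simp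

lemma integrableOn_exp_neg_mul_sub_mul {μ : ℝ} (hμ : 0 < μ) {q : ℝ → ℝ} (hq : Integrable q)
    (t : ℝ) : IntegrableOn (fun s => exp (-(μ * (t - s))) * q s) (Set.Iic t) := by
  refine hq.integrableOn.bdd_mul (c := 1) (by fun_prop) ?_
  filter_upwards [ae_restrict_mem measurableSet_Iic] with s hs
  rw [norm_of_nonneg (exp_pos _).le, exp_le_one_iff]
  nlinarith [Set.mem_Iic.mp hs]

lemma integrableOn_exp_neg_mul_sub_mul_of_sq {μ : ℝ} (hμ : 0 < μ) {g : ℝ → ℝ} (hg : Measurable g)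
    (hg2 : Integrable fun s => g s ^ 2) (t : ℝ) :
    IntegrableOn (fun s => exp (-(μ * (t - s))) * g s) (Set.Iic t) := by
  refine ((integrableOn_exp_neg_mul_sub hμ t).add
    (integrableOn_exp_neg_mul_sub_mul hμ hg2 t)).mono' (by fun_prop) (ae_of_all _ fun s => ?_)
  rw [norm_mul, norm_of_nonneg (exp_pos _).le, norm_eq_abs, Pi.add_apply, ← mul_one_add]
  gcongr
  nlinarith [sq_abs (g s), sq_nonneg (|g s| - 1)]

/-- Cauchy–Schwarz for the measure `exp (-(μ * (t - s))) ds` on `(-∞, t]`. -/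
lemma sq_integral_exp_neg_mul_sub_mul_le {μ : ℝ} (hμ : 0 < μ) {g : ℝ → ℝ} (hg : Measurable g)
    (hg2 : Integrable fun s => g s ^ 2) (t : ℝ) :
    (∫ s in Set.Iic t, exp (-(μ * (t - s))) * g s) ^ 2 ≤
      μ⁻¹ * ∫ s in Set.Iic t, exp (-(μ * (t - s))) * g s ^ 2 := by
  set A := ∫ s in Set.Iic t, exp (-(μ * (t - s))) * g s with hA
  set B := ∫ s in Set.Iic t, exp (-(μ * (t - s))) * g s ^ 2 with hB
  have h0 : 0 ≤ ∫ s in Set.Iic t, exp (-(μ * (t - s))) * (g s - μ * A) ^ 2 :=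
    integral_nonneg fun s => by positivity
  have hexpand (s : ℝ) : exp (-(μ * (t - s))) * (g s - μ * A) ^ 2 =
      exp (-(μ * (t - s))) * g s ^ 2 - 2 * μ * A * (exp (-(μ * (t - s))) * g s) +
        (μ * A) ^ 2 * exp (-(μ * (t - s))) := by ring
  have i1 := integrableOn_exp_neg_mul_sub_mul hμ hg2 t
  have i2 := (integrableOn_exp_neg_mul_sub_mul_of_sq hμ hg hg2 t).const_mul (2 * μ * A)
  have i3 := (integrableOn_exp_neg_mul_sub hμ t).const_mul ((μ * A) ^ 2)
  have i12 : IntegrableOn (fun s => exp (-(μ * (t - s))) * g s ^ 2 -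
      2 * μ * A * (exp (-(μ * (t - s))) * g s)) (Set.Iic t) := i1.sub i2
  simp_rw [hexpand] at h0
  rw [integral_add i12 i3, integral_sub i1 i2, integral_const_mul, integral_const_mul,
    integral_exp_neg_mul_sub hμ, ← hA, ← hB] at h0
  have h1 : (μ * A) ^ 2 * μ⁻¹ = μ * A ^ 2 := by field_simp
  rw [h1] at h0
  rw [inv_mul_eq_div, le_div_iff₀ hμ]
  linarith

lemma integrable_and_integral_exp_convolution {μ : ℝ} (hμ : 0 < μ) {q : ℝ → ℝ}
    (hq : Integrable q) :
    Integrable (fun t => ∫ s in Set.Iic t, exp (-(μ * (t - s))) * q s) ∧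
      ∫ t, ∫ s in Set.Iic t, exp (-(μ * (t - s))) * q s = μ⁻¹ * ∫ t, q t := by
  set k : ℝ → ℝ := (Set.Ici 0).indicator fun x => exp (-μ * x) with hk
  have hki : Integrable k := by
    rw [hk, integrable_indicator_iff measurableSet_Ici, integrableOn_Ici_iff_integrableOn_Ioi]
    exact integrableOn_exp_mul_Ioi (by linarith) 0
  have hkint : ∫ x, k x = μ⁻¹ := by
    rw [hk, integral_indicator measurableSet_Ici, integral_Ici_eq_integral_Ioi,
      integral_exp_mul_Ioi (by linarith) 0]
    simp [neg_div_neg_eq]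
  have hconv : (fun t => ∫ s in Set.Iic t, exp (-(μ * (t - s))) * q s) =
      convolution q k (ContinuousLinearMap.mul ℝ ℝ) volume := by
    funext t
    rw [convolution_def, ← integral_indicator measurableSet_Iic]
    refine integral_congr_ae (ae_of_all _ fun s => ?_)
    by_cases hs : s ≤ t <;> simp [hk, Set.indicator, hs, mul_comm]
  rw [hconv]
  refine ⟨hq.integrable_convolution _ hki, ?_⟩
  rw [integral_convolution _ hq hki, hkint, ContinuousLinearMap.mul_apply', mul_comm]

lemma eq_zero_of_integrable_const_mul_exp_neg {μ C : ℝ} (hμ : 0 < μ)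
    (h : Integrable fun t => C * exp (-(μ * t))) : C = 0 := by
  have hc : IntegrableOn (fun _ : ℝ => C) (Set.Iic 0) := by
    refine Integrable.mono (h.integrableOn (s := Set.Iic 0)) (by fun_prop) ?_
    filter_upwards [ae_restrict_mem measurableSet_Iic] with t ht
    rw [norm_mul, norm_of_nonneg (exp_pos _).le]
    refine le_mul_of_one_le_right (norm_nonneg _) (one_le_exp ?_)
    nlinarith [Set.mem_Iic.mp ht]
  rw [integrableOn_const_iff] at hc
  simpa using hc

/-- **Scalar mode solver, stable case (`θ < λ`).** For `h` measurable with
`∫ e^{2θt} h(t)² dt < ∞`, the function `v(t) = ∫_{−∞}^t e^{−λ(t−s)} h(s) ds` is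
well-defined, locally absolutely continuous (encoded via the integral identity
`v t = v a + ∫_a^t (h − λ v)` together with local integrability of `h − λ v`), solves
`v' + λv = h` a.e., belongs to the weighted space with
`∫ e^{2θt} v² ≤ (λ−θ)⁻² ∫ e^{2θt} h²`, and is the unique such solution. -/
theorem stmt_7 (lam θ : ℝ) (hθ : θ < lam) (h : ℝ → ℝ) (hmeas : Measurable h)
    (hL2 : Integrable (fun t => exp (2 * θ * t) * h t ^ 2))
    (v : ℝ → ℝ) (hv : ∀ t, v t = ∫ s in Set.Iic t, exp (-(lam * (t - s))) * h s) :
    (∀ t : ℝ, IntegrableOn (fun s => exp (-(lam * (t - s))) * h s) (Set.Iic t)) ∧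
    (∀ a b : ℝ, IntegrableOn (fun s => h s - lam * v s) (Set.uIcc a b)) ∧
    (∀ a t : ℝ, v t = v a + ∫ s in a..t, (h s - lam * v s)) ∧
    Integrable (fun t => exp (2 * θ * t) * v t ^ 2) ∧
    (∫ t, exp (2 * θ * t) * v t ^ 2) ≤ ((lam - θ)⁻¹) ^ 2 * ∫ t, exp (2 * θ * t) * h t ^ 2 ∧
    (∀ w : ℝ → ℝ,
        (∀ a b : ℝ, IntegrableOn (fun s => h s - lam * w s) (Set.uIcc a b)) →
        (∀ a t : ℝ, w t = w a + ∫ s in a..t, (h s - lam * w s)) →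
        Integrable (fun t => exp (2 * θ * t) * w t ^ 2) → w = v) := by
  have hμ : 0 < lam - θ := sub_pos.mpr hθ
  set g : ℝ → ℝ := fun s => exp (θ * s) * h s with hg
  have hgm : Measurable g := by fun_prop
  have hsq (x y : ℝ) : (exp (θ * x) * y) ^ 2 = exp (2 * θ * x) * y ^ 2 := by
    rw [mul_pow, ← exp_nat_mul]; ring_nf
  have hg2 : Integrable fun s => g s ^ 2 := by simpa only [hg, hsq] using hL2
  have hker (t s : ℝ) : exp (-(lam * (t - s))) * h s =
      exp (-(θ * t)) * (exp (-((lam - θ) * (t - s))) * g s) := by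
    simp only [hg, ← mul_assoc, ← exp_add]; ring_nf
  have hwell (t : ℝ) : IntegrableOn (fun s => exp (-(lam * (t - s))) * h s) (Set.Iic t) := by
    simp_rw [hker]
    exact (integrableOn_exp_neg_mul_sub_mul_of_sq hμ hgm hg2 t).const_mul _
  have hvg (t : ℝ) : exp (θ * t) * v t =
      ∫ s in Set.Iic t, exp (-((lam - θ) * (t - s))) * g s := by
    simp_rw [hv, hker]
    rw [integral_const_mul, ← mul_assoc, ← exp_add]
    simp
  set F : ℝ → ℝ := fun t => ∫ s in Set.Iic t, exp (lam * s) * h s with hF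
  have hsplit (t s : ℝ) : exp (lam * s) * h s =
      exp (lam * t) * (exp (-(lam * (t - s))) * h s) := by
    rw [← mul_assoc, ← exp_add]; ring_nf
  have hFi (t : ℝ) : IntegrableOn (fun s => exp (lam * s) * h s) (Set.Iic t) := by
    simp_rw [hsplit t]
    exact (hwell t).const_mul _
  have hFv (t : ℝ) : F t = exp (lam * t) * v t := by
    simp_rw [hF, hsplit t, integral_const_mul, hv]
  have hFii (a b : ℝ) : IntervalIntegrable (fun s => exp (lam * s) * h s) volume a b := by
    rw [intervalIntegrable_iff']
    exact (hFi (max a b)).mono_set fun x hx => hx.2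
  have hFeq (a t : ℝ) : F t = F a + ∫ s in a..t, exp (lam * s) * h s := by
    rw [← intervalIntegral.integral_Iic_sub_Iic (hFi a) (hFi t)]
    ring
  have hvF (t : ℝ) : v t = exp (-lam * t) * F t := by
    rw [hFv, ← mul_assoc, ← exp_add]; simp
  have hvc : Continuous v := by
    have := continuous_of_eq_add_integral hFii hFeq
    rw [funext hvF]
    fun_prop
  have hintegrand (s : ℝ) : exp (-lam * s) * (exp (lam * s) * h s + -lam * F s) =
      h s - lam * v s := by
    rw [hvF s, mul_add, ← mul_assoc, ← exp_add]; simp; ring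
  have hvi (a t : ℝ) : v t = v a + ∫ s in a..t, (h s - lam * v s) := by
    have := exp_mul_eq_add_integral (-lam) hFii hFeq a t
    simp_rw [hintegrand] at this
    rwa [← hvF, ← hvF] at this
  have hhi (a b : ℝ) : IntervalIntegrable h volume a b := by
    refine ((hFii a b).continuousOn_mul (g := fun s => exp (-lam * s)) (by fun_prop)).congr
      fun s _ => ?_
    simp [← mul_assoc, ← exp_add]
  obtain ⟨hci, hcint⟩ := integrable_and_integral_exp_convolution hμ hg2
  have hle (t : ℝ) : exp (2 * θ * t) * v t ^ 2 ≤
      (lam - θ)⁻¹ * ∫ s in Set.Iic t, exp (-((lam - θ) * (t - s))) * g s ^ 2 := by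
    rw [← hsq, hvg]
    exact sq_integral_exp_neg_mul_sub_mul_le hμ hgm hg2 t
  have hv2 : Integrable fun t => exp (2 * θ * t) * v t ^ 2 := by
    refine (hci.const_mul (lam - θ)⁻¹).mono' (by fun_prop) (ae_of_all _ fun t => ?_)
    rw [norm_of_nonneg (by positivity)]
    exact hle t
  refine ⟨hwell, fun a b => ?_, hvi, hv2, ?_, fun w hwi hw hw2 => ?_⟩
  · rw [← intervalIntegrable_iff']
    exact (hhi a b).sub ((by fun_prop : Continuous fun s => lam * v s).intervalIntegrable a b)
  · calc ∫ t, exp (2 * θ * t) * v t ^ 2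
        ≤ ∫ t, (lam - θ)⁻¹ * ∫ s in Set.Iic t, exp (-((lam - θ) * (t - s))) * g s ^ 2 :=
          integral_mono hv2 (hci.const_mul _) hle
      _ = ((lam - θ)⁻¹) ^ 2 * ∫ t, exp (2 * θ * t) * h t ^ 2 := by
          rw [integral_const_mul, hcint]
          simp only [hg, hsq]
          ring
  · have hwii (a b : ℝ) : IntervalIntegrable (fun s => h s - lam * w s) volume a b := by
      rw [intervalIntegrable_iff']
      exact hwi a b
    have hwc : Continuous w := continuous_of_eq_add_integral hwii hw
    set C := w 0 - v 0 with hC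
    have hdiff (t : ℝ) : w t - v t = exp (-lam * t) * C := by
      have hwe := exp_mul_eq_add_integral lam hwii hw 0 t
      have hve := hFeq 0 t
      simp only [sub_add_cancel] at hwe
      rw [hFv, hFv] at hve
      have : exp (lam * t) * (w t - v t) = C := by
        simp only [mul_zero, exp_zero, one_mul] at hwe hve
        linarith
      rw [← this, ← mul_assoc, ← exp_add]
      simp
    have hint : Integrable fun t => exp (2 * θ * t) * (w t - v t) ^ 2 := by
      refine ((hw2.add hv2).const_mul 2).mono' (by fun_prop) (ae_of_all _ fun t => ?_)
      rw [norm_of_nonneg (by positivity), Pi.add_apply, ← mul_add, mul_left_comm]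
      gcongr
      nlinarith [sq_nonneg (w t + v t)]
    have hC0 : C ^ 2 = 0 := by
      refine eq_zero_of_integrable_const_mul_exp_neg (μ := 2 * (lam - θ)) (by linarith)
        (hint.congr (ae_of_all _ fun t => ?_))
      simp only [hdiff]
      rw [mul_pow, ← exp_nat_mul, ← mul_assoc, ← exp_add, mul_comm]
      ring_nf
    funext t
    have := hdiff t
    rw [pow_eq_zero_iff two_ne_zero |>.mp hC0, mul_zero] at this
    linarith
end

section
/- Sell's explicit solution: define C_0 := 1 and C_n := C_{n−1}² / (2^n − 1) for n ≥ 1, and define u_1(t) := e^{−t} and u_{n+1}(t) := C_n e^{−2^n t} t^{2^n − 1} for n ≥ 1. Then u_1'(t) + u_1(t) = 0 for all t ∈ ℝ, and for every n ≥ 1 and every t ∈ ℝ one has u_{n+1}'(t) + 2^n u_{n+1}(t) = u_n(t)²; that is, the sequence (u_n) is an explicit solution of Sell's system du_1/dt + u_1 = 0, du_n/dt + 2^{n−1} u_n = u_{n−1}² (n ≥ 2). -/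
open Real

/-- **Sell's explicit solution (Example 6.3).** With `C 0 = 1`,
`C n = C (n-1)² / (2ⁿ − 1)` for `n ≥ 1`, `u 1 t = e^{−t}` and
`u (n+1) t = C n · e^{−2ⁿ t} · t^{2ⁿ−1}` for `n ≥ 1`, one has `u₁' + u₁ = 0` and
`u_{n+1}' + 2ⁿ u_{n+1} = u_n²` for every `n ≥ 1`; i.e. `(u_n)` is an explicit solution of
Sell's system `du₁/dt + u₁ = 0`, `du_n/dt + 2^{n−1} u_n = u_{n−1}²` (`n ≥ 2`). -/
theorem stmt_15 (C : ℕ → ℝ) (hC0 : C 0 = 1)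
    (hC : ∀ n : ℕ, 1 ≤ n → C n = C (n - 1) ^ 2 / ((2 : ℝ) ^ n - 1))
    (u : ℕ → ℝ → ℝ) (hu1 : ∀ t : ℝ, u 1 t = exp (-t))
    (hun : ∀ n : ℕ, 1 ≤ n → ∀ t : ℝ,
        u (n + 1) t = C n * exp (-((2 : ℝ) ^ n * t)) * t ^ (2 ^ n - 1)) :
    (∀ t : ℝ, HasDerivAt (u 1) (-u 1 t) t) ∧
    ∀ n : ℕ, 1 ≤ n → ∀ t : ℝ,
      HasDerivAt (u (n + 1)) (u n t ^ 2 - (2 : ℝ) ^ n * u (n + 1) t) t := by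
  have hu : ∀ n : ℕ, ∀ t : ℝ,
      u (n + 1) t = C n * exp (-((2 : ℝ) ^ n * t)) * t ^ (2 ^ n - 1) := by
    intro n t
    rcases Nat.eq_zero_or_pos n with rfl | hn
    · simp [hu1, hC0]
    · exact hun n hn t
  refine ⟨fun t => ?_, fun n hn t => ?_⟩
  · rw [funext hu1]
    simpa using (hasDerivAt_neg t).exp
  · obtain ⟨m, rfl⟩ := Nat.exists_eq_add_of_le' hn
    obtain ⟨k, hk⟩ : ∃ k, 2 ^ m = k + 1 := Nat.exists_eq_add_of_le' Nat.one_le_two_pow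
    have hkR : (2 : ℝ) ^ m = k + 1 := by exact_mod_cast hk
    have hexp : 2 ^ (m + 1) - 1 = 2 * k + 1 := by rw [pow_succ, hk]; omega
    have hCm : C (m + 1) * (2 * k + 1) = C m ^ 2 := by
      have hk0 : (2 * k + 1 : ℝ) ≠ 0 := by positivity
      have hden : (2 : ℝ) ^ (m + 1) - 1 = 2 * k + 1 := by rw [pow_succ, hkR]; ring
      rw [hC (m + 1) hn, hden, Nat.add_sub_cancel, div_mul_cancel₀ _ hk0]
    have hsq : exp (-((2 : ℝ) ^ (m + 1) * t)) = exp (-((2 : ℝ) ^ m * t)) ^ 2 := by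
      rw [← exp_nat_mul]
      congr 1
      push_cast
      ring
    have hE : HasDerivAt (fun s : ℝ => exp (-((2 : ℝ) ^ (m + 1) * s)))
        (exp (-((2 : ℝ) ^ (m + 1) * t)) * -(2 ^ (m + 1) * 1)) t :=
      ((hasDerivAt_id t).const_mul _).neg.exp
    have hd := (hE.const_mul (C (m + 1))).mul (hasDerivAt_pow (2 * k + 1) t)
    rw [hu m, funext (hu (m + 1)), hexp, hk, Nat.add_sub_cancel]
    refine hd.congr_deriv ?_
    simp only [Nat.add_sub_cancel, hsq]
    push_cast
    linear_combination exp (-((2 : ℝ) ^ m * t)) ^ 2 * t ^ (2 * k) * hCm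
end

section
/- Decay of the Sell coefficients and ℓ²-well-definedness: let C_0 := 1 and C_n := C_{n−1}² / (2^n − 1) for n ≥ 1. Then there exists α > 0 such that C_n ≤ 2^{−α·2^n} for all n ≥ 2. Consequently: (i) for every t ≥ 0 the sequence (u_n(t))_{n≥1} with u_1(t) = e^{−t} and u_{n+1}(t) = C_n e^{−2^n t} t^{2^n−1} is square-summable, i.e. defines an element of ℓ²; and (ii) there exists β ∈ (0,1) such that for every p with 0 < |p| < β the sequence (M_{n+1}(p))_{n≥1}, where M_{n+1}(p) := C_n p^{2^n} (ln(1/|p|))^{2^n − 1}, is square-summable, i.e. Σ_{n≥1} M_{n+1}(p)² < ∞. -/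
open Real

/-- The Sell coefficients lie in `[0, 1]`. -/
theorem sell_coeff_mem_Icc {C : ℕ → ℝ} (hC0 : C 0 = 1)
    (hC : ∀ n : ℕ, 1 ≤ n → C n = C (n - 1) ^ 2 / ((2 : ℝ) ^ n - 1)) (n : ℕ) :
    0 ≤ C n ∧ C n ≤ 1 := by
  induction n with
  | zero => simp [hC0]
  | succ n ih =>
    have h1 : (1 : ℝ) ≤ 2 ^ (n + 1) - 1 := by
      have := one_le_pow₀ (n := n) (one_le_two (α := ℝ))
      rw [pow_succ]; linarith
    rw [hC (n + 1) (by omega), Nat.add_sub_cancel]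
    refine ⟨by positivity, div_le_one_of_le₀ ?_ (by linarith)⟩
    nlinarith [ih.1, ih.2]

/-- Each Sell coefficient is at most the square of its predecessor. -/
theorem sell_coeff_succ_le_sq {C : ℕ → ℝ}
    (hC : ∀ n : ℕ, 1 ≤ n → C n = C (n - 1) ^ 2 / ((2 : ℝ) ^ n - 1)) (n : ℕ) :
    C (n + 1) ≤ C n ^ 2 := by
  have h1 : (1 : ℝ) ≤ 2 ^ (n + 1) - 1 := by
    have := one_le_pow₀ (n := n) (one_le_two (α := ℝ))
    rw [pow_succ]; linarith
  rw [hC (n + 1) (by omega), Nat.add_sub_cancel]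
  exact div_le_self (sq_nonneg _) h1

/-- The Sell coefficients decay at least geometrically. -/
theorem sell_coeff_succ_le_geometric {C : ℕ → ℝ} (hC0 : C 0 = 1)
    (hC : ∀ n : ℕ, 1 ≤ n → C n = C (n - 1) ^ 2 / ((2 : ℝ) ^ n - 1)) (n : ℕ) :
    C (n + 1) ≤ (1 / 2) ^ n := by
  have h1 : (2 : ℝ) ^ n ≤ 2 ^ (n + 1) - 1 := by
    have := one_le_pow₀ (n := n) (one_le_two (α := ℝ))
    rw [pow_succ]; linarith
  obtain ⟨h0, hle⟩ := sell_coeff_mem_Icc hC0 hC n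
  rw [hC (n + 1) (by omega), Nat.add_sub_cancel, one_div_pow]
  exact div_le_div₀ zero_le_one (by nlinarith) (by positivity) h1

theorem summable_sell_coeff_sq {C : ℕ → ℝ} (hC0 : C 0 = 1)
    (hC : ∀ n : ℕ, 1 ≤ n → C n = C (n - 1) ^ 2 / ((2 : ℝ) ^ n - 1)) :
    Summable fun n : ℕ => C n ^ 2 := by
  rw [← summable_nat_add_iff 1]
  refine Summable.of_nonneg_of_le (fun n => sq_nonneg _) (fun n => ?_)
    summable_geometric_two
  obtain ⟨h0, hle⟩ := sell_coeff_mem_Icc hC0 hC (n + 1)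
  have := sell_coeff_succ_le_geometric hC0 hC n
  nlinarith

/-- A sequence dominated in absolute value by the Sell coefficients from index `1` on is
square-summable. -/
theorem summable_sq_of_abs_le_sell_coeff {C : ℕ → ℝ} (hC0 : C 0 = 1)
    (hC : ∀ n : ℕ, 1 ≤ n → C n = C (n - 1) ^ 2 / ((2 : ℝ) ^ n - 1))
    {a : ℕ → ℝ} (ha : ∀ n, 1 ≤ n → |a n| ≤ C n) : Summable fun n : ℕ => a n ^ 2 := by
  rw [← summable_nat_add_iff 1]
  refine Summable.of_nonneg_of_le (fun n => sq_nonneg _) (fun n => ?_)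
    ((summable_nat_add_iff 1).2 (summable_sell_coeff_sq hC0 hC))
  rw [← sq_abs]
  exact pow_le_pow_left₀ (abs_nonneg _) (ha (n + 1) (by omega)) 2

theorem pow_mul_pow_pred_le_one {x y : ℝ} (hx : 0 ≤ x) (hx1 : x ≤ 1) (hy : 0 ≤ y)
    (hxy : x * y ≤ 1) {m : ℕ} (hm : m ≠ 0) : x ^ m * y ^ (m - 1) ≤ 1 := by
  obtain ⟨k, rfl⟩ := Nat.exists_eq_succ_of_ne_zero hm
  rw [Nat.succ_sub_one, Nat.succ_eq_add_one, pow_succ, mul_right_comm, ← mul_pow]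
  exact mul_le_one₀ (pow_le_one₀ (by positivity) hxy) hx hx1

/-- **Decay of the Sell coefficients and ℓ²-well-definedness (Example 6.3).** With
`C 0 = 1`, `C n = C (n-1)²/(2ⁿ−1)` for `n ≥ 1`, there is `α > 0` with
`C n ≤ 2^{−α·2ⁿ}` for all `n ≥ 2`.  Consequently (i) for every `t ≥ 0` the sequence
`(u_n(t))_{n≥1}` (where `u 1 t = e^{−t}`, `u (n+1) t = C n e^{−2ⁿt} t^{2ⁿ−1}`) is
square-summable, i.e. defines an element of `ℓ²`; and (ii) there is `β ∈ (0,1)` such that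
for `0 < |p| < β` the sequence `(M_{n+1}(p))_{n≥1}`, with
`M (n+1) p = C n · p^{2ⁿ} · (ln(1/|p|))^{2ⁿ−1}`, is square-summable. -/
theorem stmt_16 (C : ℕ → ℝ) (hC0 : C 0 = 1)
    (hC : ∀ n : ℕ, 1 ≤ n → C n = C (n - 1) ^ 2 / ((2 : ℝ) ^ n - 1))
    (u : ℕ → ℝ → ℝ) (hu1 : ∀ t : ℝ, u 1 t = exp (-t))
    (hun : ∀ n : ℕ, 1 ≤ n → ∀ t : ℝ,
        u (n + 1) t = C n * exp (-((2 : ℝ) ^ n * t)) * t ^ (2 ^ n - 1))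
    (M : ℕ → ℝ → ℝ)
    (hM : ∀ n : ℕ, 1 ≤ n → ∀ p : ℝ,
        M (n + 1) p = C n * p ^ (2 ^ n) * Real.log (1 / |p|) ^ (2 ^ n - 1)) :
    (∃ α : ℝ, 0 < α ∧ ∀ n : ℕ, 2 ≤ n → C n ≤ (2 : ℝ) ^ (-(α * (2 : ℝ) ^ n))) ∧
    (∀ t : ℝ, 0 ≤ t → Summable fun n : ℕ => u (n + 1) t ^ 2) ∧
    (∃ β : ℝ, 0 < β ∧ β < 1 ∧
        ∀ p : ℝ, 0 < |p| → |p| < β → Summable fun n : ℕ => M (n + 1) p ^ 2) := by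
  have hnn := fun n => (sell_coeff_mem_Icc hC0 hC n).1
  refine ⟨⟨1 / 4, by norm_num, ?_⟩, ?_, 1 / 2, by norm_num, by norm_num, ?_⟩
  · intro n hn
    induction n, hn using Nat.le_induction with
    | base =>
      have h1 : C 1 = 1 := by rw [hC 1 le_rfl]; norm_num [hC0]
      rw [hC 2 (by norm_num), show -(1 / 4 * (2 : ℝ) ^ 2) = -1 by norm_num, rpow_neg_one]
      norm_num [h1]
    | succ n _ ih =>
      calc C (n + 1) ≤ C n ^ 2 := sell_coeff_succ_le_sq hC n
        _ ≤ ((2 : ℝ) ^ (-(1 / 4 * (2 : ℝ) ^ n))) ^ 2 := pow_le_pow_left₀ (hnn n) ih 2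
        _ = (2 : ℝ) ^ (-(1 / 4 * (2 : ℝ) ^ (n + 1))) := by
          rw [← rpow_natCast, ← rpow_mul zero_le_two]
          congr 1
          push_cast
          ring
  · intro t ht
    refine summable_sq_of_abs_le_sell_coeff hC0 hC fun n hn => ?_
    have hexp : exp (-((2 : ℝ) ^ n * t)) = exp (-t) ^ (2 ^ n) := by
      rw [← exp_nat_mul]
      push_cast
      ring_nf
    have hxy : exp (-t) * t ≤ 1 := by
      rw [exp_neg, inv_mul_le_one₀ (exp_pos t)]
      linarith [add_one_le_exp t]
    rw [hun n hn, hexp, mul_assoc, abs_of_nonneg (mul_nonneg (hnn n) (by positivity))]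
    exact mul_le_of_le_one_right (hnn n) (pow_mul_pow_pred_le_one (exp_pos _).le
      (exp_le_one_iff.2 (by linarith)) ht hxy (by positivity))
  · intro p hp hp2
    refine summable_sq_of_abs_le_sell_coeff hC0 hC fun n hn => ?_
    have hlog : 0 ≤ log (1 / |p|) := log_nonneg ((one_le_div hp).2 (by linarith))
    have hxy : |p| * log (1 / |p|) ≤ 1 := by
      rw [← le_div_iff₀' hp]
      linarith [log_le_sub_one_of_pos (one_div_pos.2 hp)]
    rw [hM n hn, mul_assoc, abs_mul, abs_mul, abs_pow, abs_pow, abs_of_nonneg (hnn n),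
      abs_of_nonneg hlog]
    exact mul_le_of_le_one_right (hnn n) (pow_mul_pow_pred_le_one hp.le (by linarith)
      hlog hxy (by positivity))
end

section
/- For every integer m ≥ 1 and every β ∈ (0,1), the function f_m : (−β,β) → ℝ defined by f_m(0) := 0 and f_m(p) := p^{2^m} (ln(1/|p|))^{2^m − 1} for p ≠ 0 is (2^m − 1)-times continuously differentiable on (−β,β), and for every ε ∈ (0,1) its derivative of order 2^m − 1 is ε-Hölder continuous on (−β,β). -/
open Real

open Polynomial in
/-- The function `x ↦ x ^ k * P (log |x|)`. -/
noncomputable def powMulLogPoly (k : ℕ) (P : ℝ[X]) (x : ℝ) : ℝ := x ^ k * P.eval (log x)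

open Polynomial in
theorem exists_abs_eval_le_exp (P : ℝ[X]) {δ : ℝ} (hδ : 0 < δ) :
    ∃ C : ℝ, 0 ≤ C ∧ ∀ u : ℝ, |P.eval u| ≤ C * exp (δ * |u|) := by
  induction P using Polynomial.induction_on' with
  | add P Q hP hQ =>
    obtain ⟨C, hC, h⟩ := hP
    obtain ⟨D, hD, h'⟩ := hQ
    refine ⟨C + D, by positivity, fun u => ?_⟩
    rw [eval_add, add_mul]
    exact (abs_add_le _ _).trans (add_le_add (h u) (h' u))
  | monomial j a =>
    refine ⟨|a| * (j.factorial / δ ^ j), by positivity, fun u => ?_⟩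
    have h := pow_div_factorial_le_exp (δ * |u|) (by positivity) j
    rw [div_le_iff₀ (by positivity), mul_pow] at h
    rw [eval_monomial, abs_mul, abs_pow, mul_assoc]
    gcongr
    rw [div_mul_eq_mul_div, le_div_iff₀ (by positivity)]
    linarith

open Polynomial in
theorem exists_abs_eval_log_le_rpow (P : ℝ[X]) {δ : ℝ} (hδ : 0 < δ) :
    ∃ C : ℝ, 0 ≤ C ∧ ∀ x : ℝ, x ≠ 0 → |x| < 1 → |P.eval (log x)| ≤ C * |x| ^ (-δ) := by
  obtain ⟨C, hC, h⟩ := exists_abs_eval_le_exp P hδ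
  refine ⟨C, hC, fun x hx hx1 => (h _).trans_eq ?_⟩
  have hlog : |log x| = -log |x| := by
    rw [log_abs, abs_of_neg]
    rw [← log_abs]
    exact log_neg (abs_pos.2 hx) hx1
  rw [hlog, rpow_def_of_pos (abs_pos.2 hx)]
  ring_nf

open Polynomial in
theorem powMulLogPoly_zero {k : ℕ} (hk : k ≠ 0) (P : ℝ[X]) : powMulLogPoly k P 0 = 0 := by
  simp [powMulLogPoly, hk]

open Polynomial in
theorem powMulLogPoly_succ (k : ℕ) (P : ℝ[X]) :
    powMulLogPoly (k + 1) P = fun x => x * powMulLogPoly k P x := by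
  ext x
  simp only [powMulLogPoly]
  ring

open Polynomial in
theorem hasDerivAt_powMulLogPoly_of_ne_zero (k : ℕ) (P : ℝ[X]) {x : ℝ} (hx : x ≠ 0) :
    HasDerivAt (powMulLogPoly (k + 1) P)
      (powMulLogPoly k (C ((k : ℝ) + 1) * P + derivative P) x) x := by
  have h := (hasDerivAt_pow (k + 1) x).mul ((P.hasDerivAt (log x)).comp x (hasDerivAt_log hx))
  refine h.congr_deriv ?_
  simp only [powMulLogPoly, eval_add, eval_mul, eval_C, Function.comp_apply, Nat.add_sub_cancel]
  push_cast
  field_simp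
  ring

open Polynomial Filter Topology in
theorem continuousAt_powMulLogPoly_zero (k : ℕ) (P : ℝ[X]) :
    ContinuousAt (powMulLogPoly (k + 1) P) 0 := by
  induction k with
  | zero =>
    obtain ⟨C, -, h⟩ := exists_abs_eval_log_le_rpow P (δ := 1 / 2) (by norm_num)
    rw [ContinuousAt, powMulLogPoly_zero (by simp)]
    have hlim : Tendsto (fun x : ℝ => C * |x| ^ (1 / 2 : ℝ)) (𝓝 0) (𝓝 0) := by
      have : Continuous (fun x : ℝ => C * |x| ^ (1 / 2 : ℝ)) :=
        continuous_const.mul (continuous_abs.rpow_const fun _ => Or.inr (by norm_num))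
      simpa using this.tendsto 0
    refine squeeze_zero_norm' ?_ hlim
    filter_upwards [Metric.ball_mem_nhds (0 : ℝ) one_pos] with x hx
    rw [mem_ball_zero_iff, norm_eq_abs] at hx
    rcases eq_or_ne x 0 with rfl | hx0
    · simp [powMulLogPoly]
    · have hpos : 0 < |x| := abs_pos.2 hx0
      have hsplit : |x| ^ (1 / 2 : ℝ) = |x| * |x| ^ (-(1 / 2) : ℝ) := by
        rw [← rpow_one_add' hpos.le (by norm_num)]
        norm_num
      rw [norm_eq_abs, powMulLogPoly, abs_mul, zero_add, pow_one, hsplit]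
      calc |x| * |P.eval (log x)| ≤ |x| * (C * |x| ^ (-(1 / 2) : ℝ)) := by
            gcongr
            exact h x hx0 hx
        _ = _ := by ring
  | succ k ih =>
    rw [powMulLogPoly_succ]
    exact continuousAt_id.mul ih

open Polynomial in
theorem continuous_powMulLogPoly (k : ℕ) (P : ℝ[X]) : Continuous (powMulLogPoly (k + 1) P) := by
  refine continuous_iff_continuousAt.2 fun x => ?_
  rcases eq_or_ne x 0 with rfl | hx
  · exact continuousAt_powMulLogPoly_zero k P
  · exact (hasDerivAt_powMulLogPoly_of_ne_zero k P hx).continuousAt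

open Polynomial in
theorem hasDerivAt_powMulLogPoly (k : ℕ) (P : ℝ[X]) (x : ℝ) :
    HasDerivAt (powMulLogPoly (k + 2) P)
      (powMulLogPoly (k + 1) (C ((k : ℝ) + 2) * P + derivative P) x) x := by
  rcases eq_or_ne x 0 with rfl | hx
  · rw [powMulLogPoly_zero (by simp), hasDerivAt_iff_tendsto_slope]
    have h := continuousAt_powMulLogPoly_zero k P
    rw [ContinuousAt, powMulLogPoly_zero (by simp)] at h
    refine (h.mono_left nhdsWithin_le_nhds).congr' ?_
    filter_upwards [self_mem_nhdsWithin] with y hy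
    have hy0 : y ≠ 0 := hy
    rw [slope_def_field, powMulLogPoly_zero (by simp), powMulLogPoly_succ (k + 1)]
    field_simp
    simp
  · convert hasDerivAt_powMulLogPoly_of_ne_zero (k + 1) P hx using 4
    push_cast
    ring_nf

open Polynomial in
theorem contDiff_powMulLogPoly (k : ℕ) (P : ℝ[X]) : ContDiff ℝ k (powMulLogPoly (k + 1) P) := by
  induction k generalizing P with
  | zero => exact contDiff_zero.2 (continuous_powMulLogPoly 0 P)
  | succ k ih =>
    rw [Nat.cast_succ, contDiff_succ_iff_deriv]
    refine ⟨fun x => (hasDerivAt_powMulLogPoly k P x).differentiableAt, by simp, ?_⟩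
    rw [funext fun x => (hasDerivAt_powMulLogPoly k P x).deriv]
    exact ih _

open Polynomial in
theorem exists_iteratedDeriv_powMulLogPoly (k : ℕ) (P : ℝ[X]) :
    ∃ Q : ℝ[X], iteratedDeriv k (powMulLogPoly (k + 1) P) = powMulLogPoly 1 Q := by
  induction k generalizing P with
  | zero => exact ⟨P, iteratedDeriv_zero⟩
  | succ k ih =>
    rw [iteratedDeriv_succ', funext fun x => (hasDerivAt_powMulLogPoly k P x).deriv]
    exact ih _

open Polynomial in
theorem powMulLogPoly_one_neg (Q : ℝ[X]) (x : ℝ) :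
    powMulLogPoly 1 Q (-x) = -powMulLogPoly 1 Q x := by
  simp [powMulLogPoly]

open Polynomial in
theorem exists_powMulLogPoly_sub_le (Q : ℝ[X]) {ε : ℝ} (hε : 0 < ε) (hε1 : ε < 1) :
    ∃ K : ℝ, 0 ≤ K ∧ ∀ x y : ℝ, 0 ≤ x → x ≤ y → y < 1 →
      powMulLogPoly 1 Q y - powMulLogPoly 1 Q x ≤ K * (y - x) ^ ε := by
  obtain ⟨D, hD, hb⟩ := exists_abs_eval_log_le_rpow
    (C (((0 : ℕ) : ℝ) + 1) * Q + derivative Q) (sub_pos.2 hε1)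
  refine ⟨D / ε, by positivity, fun x y hx hxy hy => ?_⟩
  have hmono : MonotoneOn (fun t => D / ε * t ^ ε - powMulLogPoly 1 Q t) (Set.Ico 0 1) := by
    have hderiv : ∀ t ∈ interior (Set.Ico (0 : ℝ) 1),
        HasDerivAt (fun t => D / ε * t ^ ε - powMulLogPoly 1 Q t)
          (D / ε * (ε * t ^ (ε - 1)) -
            powMulLogPoly 0 (C (((0 : ℕ) : ℝ) + 1) * Q + derivative Q) t) t := by
      intro t ht
      rw [interior_Ico] at ht
      exact ((hasDerivAt_rpow_const (Or.inl ht.1.ne')).const_mul _).sub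
        (hasDerivAt_powMulLogPoly_of_ne_zero 0 Q ht.1.ne')
    refine monotoneOn_of_deriv_nonneg (convex_Ico 0 1) ?_
      (fun t ht => (hderiv t ht).differentiableAt.differentiableWithinAt) fun t ht => ?_
    · exact ((continuous_const.mul (continuous_id.rpow_const fun _ => Or.inr hε.le)).sub
        (continuous_powMulLogPoly 0 Q)).continuousOn
    · rw [(hderiv t ht).deriv]
      rw [interior_Ico] at ht
      have h := (le_abs_self _).trans
        (hb t ht.1.ne' (by rw [abs_of_pos ht.1]; exact ht.2))
      rw [abs_of_pos ht.1, neg_sub] at h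
      rw [powMulLogPoly, pow_zero, one_mul, ← mul_assoc, div_mul_cancel₀ _ hε.ne', sub_nonneg]
      exact h
  have h := hmono ⟨hx, hxy.trans_lt hy⟩ ⟨hx.trans hxy, hy⟩ hxy
  have hadd := rpow_add_le_add_rpow (sub_nonneg.2 hxy) hx hε.le hε1.le
  rw [sub_add_cancel] at hadd
  have hmul := mul_le_mul_of_nonneg_left hadd (show 0 ≤ D / ε by positivity)
  simp only at h
  linarith

open Polynomial in
theorem exists_holder_powMulLogPoly_of_nonneg (Q : ℝ[X]) {ε : ℝ} (hε : 0 < ε) (hε1 : ε < 1) :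
    ∃ K : ℝ, 0 ≤ K ∧ ∀ x y : ℝ, 0 ≤ x → x < 1 → 0 ≤ y → y < 1 →
      |powMulLogPoly 1 Q x - powMulLogPoly 1 Q y| ≤ K * |x - y| ^ ε := by
  obtain ⟨K, hK, h⟩ := exists_powMulLogPoly_sub_le Q hε hε1
  obtain ⟨L, hL, h'⟩ := exists_powMulLogPoly_sub_le (-Q) hε hε1
  have key : ∀ x y : ℝ, 0 ≤ x → x ≤ y → y < 1 →
      |powMulLogPoly 1 Q y - powMulLogPoly 1 Q x| ≤ (K + L) * |y - x| ^ ε := by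
    intro x y hx hxy hy
    have h1 := h x y hx hxy hy
    have h2 := h' x y hx hxy hy
    simp only [powMulLogPoly, eval_neg] at h1 h2 ⊢
    have hpos : 0 ≤ (y - x) ^ ε := rpow_nonneg (sub_nonneg.2 hxy) _
    have := mul_nonneg hK hpos
    have := mul_nonneg hL hpos
    rw [abs_of_nonneg (sub_nonneg.2 hxy), abs_le, add_mul]
    constructor <;> linarith
  refine ⟨K + L, by positivity, fun x y hx hx1 hy hy1 => ?_⟩
  rcases le_total x y with hxy | hxy
  · rw [abs_sub_comm, abs_sub_comm x y]
    exact key x y hx hxy hy1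
  · exact key y x hy hxy hx1

open Polynomial in
theorem exists_holder_powMulLogPoly (Q : ℝ[X]) {ε : ℝ} (hε : 0 < ε) (hε1 : ε < 1) :
    ∃ K : ℝ, ∀ x y : ℝ, |x| < 1 → |y| < 1 →
      |powMulLogPoly 1 Q x - powMulLogPoly 1 Q y| ≤ K * |x - y| ^ ε := by
  obtain ⟨K, hK, h⟩ := exists_holder_powMulLogPoly_of_nonneg Q hε hε1
  have opposite : ∀ x y : ℝ, 0 ≤ x → x < 1 → y ≤ 0 → -1 < y →
      |powMulLogPoly 1 Q x - powMulLogPoly 1 Q y| ≤ 2 * K * |x - y| ^ ε := by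
    intro x y hx hx1 hy hy1
    have h1 := h x 0 hx hx1 le_rfl one_pos
    have h2 := h (-y) 0 (by linarith) (by linarith) le_rfl one_pos
    rw [powMulLogPoly_zero one_ne_zero, sub_zero, sub_zero] at h1 h2
    rw [powMulLogPoly_one_neg, abs_neg, abs_neg] at h2
    have hx' : |x| ≤ |x - y| := by
      rw [abs_of_nonneg hx, abs_of_nonneg (by linarith)]; linarith
    have hy' : |y| ≤ |x - y| := by
      rw [abs_of_nonpos hy, abs_of_nonneg (by linarith)]; linarith
    have h3 := mul_le_mul_of_nonneg_left (rpow_le_rpow (abs_nonneg x) hx' hε.le) hK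
    have h4 := mul_le_mul_of_nonneg_left (rpow_le_rpow (abs_nonneg y) hy' hε.le) hK
    have h5 := abs_sub (powMulLogPoly 1 Q x) (powMulLogPoly 1 Q y)
    linarith
  have same : ∀ x y : ℝ, K * |x - y| ^ ε ≤ 2 * K * |x - y| ^ ε := fun x y => by
    have := mul_nonneg hK (rpow_nonneg (abs_nonneg (x - y)) ε)
    linarith
  refine ⟨2 * K, fun x y hx hy => ?_⟩
  rw [abs_lt] at hx hy
  rcases le_total 0 x with hx0 | hx0 <;> rcases le_total 0 y with hy0 | hy0
  · exact (h x y hx0 hx.2 hy0 hy.2).trans (same x y)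
  · exact opposite x y hx0 hx.2 hy0 hy.1
  · rw [abs_sub_comm, abs_sub_comm x y]
    exact opposite y x hy0 hy.2 hx0 hx.1
  · have h1 := h (-y) (-x) (by linarith) (by linarith) (by linarith) (by linarith)
    rw [powMulLogPoly_one_neg, powMulLogPoly_one_neg, neg_sub_neg, neg_sub_neg] at h1
    exact h1.trans (same x y)

/-- **Smoothness of the components of Sell's manifold (Example 6.3).** For `m ≥ 1` and
`β ∈ (0,1)`, the function `f(p) = p^{2^m} (ln(1/|p|))^{2^m−1}` (with `f 0 = 0`) is
`(2^m − 1)`-times continuously differentiable on `(−β,β)`, and for every `ε ∈ (0,1)` its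
derivative of order `2^m − 1` is `ε`-Hölder continuous on `(−β,β)`. -/
theorem stmt_17 (m : ℕ) (hm : 1 ≤ m) (β : ℝ) (hβ : β ∈ Set.Ioo (0 : ℝ) 1)
    (f : ℝ → ℝ) (hf0 : f 0 = 0)
    (hf : ∀ p : ℝ, p ≠ 0 → f p = p ^ (2 ^ m) * Real.log (1 / |p|) ^ (2 ^ m - 1)) :
    ContDiffOn ℝ (2 ^ m - 1 : ℕ) f (Set.Ioo (-β) β) ∧
    ∀ ε : ℝ, 0 < ε → ε < 1 → ∃ K : ℝ,
      ∀ x ∈ Set.Ioo (-β) β, ∀ y ∈ Set.Ioo (-β) β,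
        |iteratedDerivWithin (2 ^ m - 1) f (Set.Ioo (-β) β) x -
            iteratedDerivWithin (2 ^ m - 1) f (Set.Ioo (-β) β) y| ≤ K * |x - y| ^ ε := by
  obtain ⟨n, hn⟩ : ∃ n, 2 ^ m = n + 1 := Nat.exists_eq_succ_of_ne_zero (by positivity)
  have hfun : f = powMulLogPoly (n + 1) ((-Polynomial.X) ^ n) := by
    ext p
    rcases eq_or_ne p 0 with rfl | hp
    · rw [hf0, powMulLogPoly_zero (by simp)]
    · rw [hf p hp, hn, powMulLogPoly]
      simp
  rw [hn, Nat.add_sub_cancel, hfun]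
  refine ⟨(contDiff_powMulLogPoly n _).contDiffOn, fun ε hε hε1 => ?_⟩
  obtain ⟨Q, hQ⟩ := exists_iteratedDeriv_powMulLogPoly n ((-Polynomial.X) ^ n)
  obtain ⟨K, hK⟩ := exists_holder_powMulLogPoly Q hε hε1
  refine ⟨K, fun x hx y hy => ?_⟩
  rw [iteratedDerivWithin_of_isOpen isOpen_Ioo hx, iteratedDerivWithin_of_isOpen isOpen_Ioo hy, hQ]
  exact hK x y ((abs_lt.2 hx).trans hβ.2) ((abs_lt.2 hy).trans hβ.2)
end

section
/- The non-smooth invariant graph in Sell's example: the function f : ℝ → ℝ defined by f(0) := 0 and f(p) := p² ln(1/|p|) for p ≠ 0 satisfies f(p e^{−t}) = e^{−2t} ( f(p) + t p² ) for all p ∈ ℝ and all t ∈ ℝ; moreover f is differentiable everywhere with f'(0) = 0, but f' is not differentiable at 0 (so f is not twice differentiable at 0). -/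
open Real

/-- The derivative of `-p² log p` is `2 (-p log p) - p`, including at the origin. -/
theorem hasDerivAt_mul_negMulLog (p : ℝ) :
    HasDerivAt (fun x : ℝ => x * negMulLog x) (2 * negMulLog p - p) p := by
  rcases eq_or_ne p 0 with rfl | hp
  · rw [hasDerivAt_iff_tendsto_slope]
    have hlim : Filter.Tendsto negMulLog (nhdsWithin 0 {0}ᶜ) (nhds (2 * negMulLog 0 - 0)) := by
      have h := (continuous_negMulLog.tendsto 0).mono_left
        (nhdsWithin_le_nhds (s := ({0}ᶜ : Set ℝ)))
      simpa using h
    refine hlim.congr' ?_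
    filter_upwards [self_mem_nhdsWithin] with x hx
    have hx' : x ≠ 0 := hx
    simp [slope_def_field, hx']
  · refine ((hasDerivAt_id p).mul (hasDerivAt_negMulLog hp)).congr_deriv ?_
    simp only [id, negMulLog]
    ring

/-- **The non-smooth invariant graph in Sell's example.** The function
`f(p) = p² ln(1/|p|)` (with `f 0 = 0`) satisfies the invariance equation
`f(p e^{−t}) = e^{−2t}(f(p) + t p²)` for all `p, t ∈ ℝ`; it is everywhere differentiable
with `f'(0) = 0`, but `f'` is not differentiable at `0` (so `f` is not twice
differentiable at `0`). -/
theorem stmt_19 (f : ℝ → ℝ) (hf0 : f 0 = 0)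
    (hf : ∀ p : ℝ, p ≠ 0 → f p = p ^ 2 * Real.log (1 / |p|)) :
    (∀ p t : ℝ, f (p * exp (-t)) = exp (-(2 * t)) * (f p + t * p ^ 2)) ∧
    (∀ p : ℝ, DifferentiableAt ℝ f p) ∧
    deriv f 0 = 0 ∧
    ¬ DifferentiableAt ℝ (deriv f) 0 := by
  have hfun : f = fun x => x * negMulLog x := by
    funext x
    rcases eq_or_ne x 0 with rfl | hx
    · simp [hf0]
    · rw [hf x hx, one_div, log_inv, log_abs, negMulLog]
      ring
  have hderiv : deriv f = fun p => 2 * negMulLog p - p := by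
    funext p
    rw [hfun]
    exact (hasDerivAt_mul_negMulLog p).deriv
  refine ⟨fun p t => ?_, fun p => ?_, ?_, fun h => ?_⟩
  · rcases eq_or_ne p 0 with rfl | hp
    · simp [hf0]
    · have hexp : exp (-(2 * t)) = exp (-t) ^ 2 := by
        rw [← exp_nat_mul]
        congr 1
        push_cast
        ring
      simp only [hfun, negMulLog]
      rw [log_mul hp (exp_ne_zero _), log_exp, hexp]
      ring
  · rw [hfun]
    exact (hasDerivAt_mul_negMulLog p).differentiableAt
  · simp [hderiv]
  · rw [hderiv] at h
    have hneg : DifferentiableAt ℝ negMulLog 0 := by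
      refine ((h.add differentiableAt_id).const_mul (2⁻¹ : ℝ)).congr_of_eventuallyEq ?_
      refine Filter.Eventually.of_forall fun x => ?_
      simp
    exact differentiableAt_negMulLog_iff.mp hneg rfl
end
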